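/- Let d ≥ 4 and let P ⊆ ℝ^d be a full-dimensional convex polytope. If P is edge-transitive, then P is vertex-transitive. -/

import Mathlib

open Set Pointwise

noncomputable section

/-- Euclidean space `ℝ^d`. -/
abbrev Euc (d : ℕ) := EuclideanSpace ℝ (Fin d)

/-- A convex polytope: the convex hull of a finite set of points. -/
def IsPolytope {d : ℕ} (P : Set (Euc d)) : Prop :=
  ∃ S : Finset (Euc d), P = convexHull ℝ (S : Set (Euc d))

/-- `P` is full-dimensional: its affine span is all of `ℝ^d`. -/
def FullDim {d : ℕ} (P : Set (Euc d)) : Prop :=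
  affineSpan ℝ P = ⊤

/-- `[v,w]` is an edge of `P`: an exposed face of `P` which is a segment with `v ≠ w`. -/
def IsEdge {d : ℕ} (P : Set (Euc d)) (v w : Euc d) : Prop :=
  v ≠ w ∧ IsExposed ℝ P (segment ℝ v w)

/-- `e` is an edge of `P`, as a set. -/
def IsEdgeSet {d : ℕ} (P e : Set (Euc d)) : Prop :=
  ∃ v w : Euc d, IsEdge P v w ∧ e = segment ℝ v w

/-- `T` is a symmetry of `P`: a linear isometry mapping `P` onto itself. -/
def IsAut {d : ℕ} (P : Set (Euc d)) (T : Euc d ≃ₗᵢ[ℝ] Euc d) : Prop :=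
  T '' P = P

/-- `P` is vertex-transitive: any vertex (extreme point) can be mapped onto any
other by a symmetry of `P`. -/
def VertexTransitive {d : ℕ} (P : Set (Euc d)) : Prop :=
  ∀ v ∈ Set.extremePoints ℝ P, ∀ w ∈ Set.extremePoints ℝ P,
    ∃ T : Euc d ≃ₗᵢ[ℝ] Euc d, IsAut P T ∧ T v = w

/-- `P` is edge-transitive: any edge can be mapped onto any other by a symmetry of `P`. -/
def EdgeTransitive {d : ℕ} (P : Set (Euc d)) : Prop :=
  ∀ e e' : Set (Euc d), IsEdgeSet P e → IsEdgeSet P e' →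
    ∃ T : Euc d ≃ₗᵢ[ℝ] Euc d, IsAut P T ∧ T '' e = e'

/-- `P` is bipartite with vertex partition `V1, V2`, radii `r1 ≤ r2` and edge length `ℓ`:
all edges have length `ℓ`, every edge joins `V1` to `V2`, where `V1 ⊔ V2` is a partition of
the vertex set, and vertices in `Vᵢ` have norm `rᵢ`. -/
def IsBipartiteWith {d : ℕ} (P V1 V2 : Set (Euc d)) (r1 r2 ℓ : ℝ) : Prop :=
  (0 < ℓ) ∧ (∀ v w : Euc d, IsEdge P v w → ‖v - w‖ = ℓ) ∧
  (V1 ∪ V2 = Set.extremePoints ℝ P) ∧ Disjoint V1 V2 ∧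
  (∀ v w : Euc d, IsEdge P v w → (v ∈ V1 ∧ w ∈ V2) ∨ (v ∈ V2 ∧ w ∈ V1)) ∧
  (0 < r1) ∧ (r1 ≤ r2) ∧ (∀ v ∈ V1, ‖v‖ = r1) ∧ (∀ v ∈ V2, ‖v‖ = r2)

/-- `P` is a bipartite polytope. -/
def IsBipartite {d : ℕ} (P : Set (Euc d)) : Prop :=
  ∃ (V1 V2 : Set (Euc d)) (r1 r2 ℓ : ℝ), IsBipartiteWith P V1 V2 r1 r2 ℓ

/-- `P` is a strictly bipartite polytope (`r1 < r2`). -/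
def IsStrictlyBipartite {d : ℕ} (P : Set (Euc d)) : Prop :=
  ∃ (V1 V2 : Set (Euc d)) (r1 r2 ℓ : ℝ), IsBipartiteWith P V1 V2 r1 r2 ℓ ∧ r1 < r2

section Polytope

variable {E : Type*} [NormedAddCommGroup E] [InnerProductSpace ℝ E]

/-- Gordan-type alternative relative to a subspace: a finite set no nontrivial nonnegative
combination of which lies in `U` is strictly negative on some vector orthogonal to `U`. -/
theorem exists_orthogonal_inner_neg [FiniteDimensional ℝ E] (S : Finset E) (U : Submodule ℝ E)
    (h : ∀ a : E → ℝ, (∀ s ∈ S, 0 ≤ a s) → ∑ s ∈ S, a s • s ∈ U → ∀ s ∈ S, a s = 0) :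
    ∃ n : E, (∀ y ∈ U, inner ℝ n y = 0) ∧ ∀ s ∈ S, inner ℝ n s < 0 := by
  let π : E →L[ℝ] E := Uᗮ.starProjection
  have h0 : (0 : E) ∉ π '' convexHull ℝ (S : Set E) := by
    rintro ⟨y, hy, hy0⟩
    obtain ⟨w, hw, hw1, rfl⟩ := Finset.mem_convexHull'.1 hy
    have hU : ∑ s ∈ S, w s • s ∈ U := by
      have := (Submodule.starProjection_apply_eq_zero_iff _).1 hy0
      rwa [Submodule.orthogonal_orthogonal] at this
    have := h w hw hU
    rw [Finset.sum_congr rfl this] at hw1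
    simp at hw1
  have hconv : Convex ℝ (π '' convexHull ℝ (S : Set E)) :=
    (convex_convexHull ℝ _).linear_image π.toLinearMap
  have hcl : IsClosed (π '' convexHull ℝ (S : Set E)) :=
    ((Set.Finite.isCompact_convexHull ℝ S.finite_toSet).image π.continuous).isClosed
  obtain ⟨f, u, hf0, hf⟩ := geometric_hahn_banach_point_closed hconv hcl h0
  rw [map_zero] at hf0
  refine ⟨-(InnerProductSpace.toDual ℝ E).symm (f.comp π), fun y hy => ?_, fun s hs => ?_⟩
  · have : π y = 0 := by
      rw [Submodule.starProjection_apply_eq_zero_iff, Submodule.orthogonal_orthogonal]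
      exact hy
    rw [inner_neg_left, InnerProductSpace.toDual_symm_apply]
    simp [this]
  · rw [inner_neg_left, InnerProductSpace.toDual_symm_apply]
    have := hf (π s) ⟨s, subset_convexHull ℝ _ hs, rfl⟩
    simp only [ContinuousLinearMap.comp_apply]
    linarith

/-- `x` is a nonnegative combination of elements of `W`. -/
def InCone (W : Finset E) (x : E) : Prop :=
  ∃ a : E → ℝ, (∀ w, 0 ≤ a w) ∧ x = ∑ w ∈ W, a w • w

theorem InCone.of_mem {W : Finset E} {x : E} (hx : x ∈ W) : InCone W x := by
  classical
  exact ⟨fun w => if w = x then 1 else 0, fun w => by positivity, by simp [hx]⟩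

theorem InCone.erase [DecidableEq E] {W : Finset E} {w x : E} (hw : w ∈ W)
    (hwc : InCone (W.erase w) w) (hx : InCone W x) : InCone (W.erase w) x := by
  obtain ⟨b, hb, hbw⟩ := hwc
  obtain ⟨a, ha, rfl⟩ := hx
  refine ⟨fun y => a w * b y + a y, fun y => add_nonneg (mul_nonneg (ha w) (hb y)) (ha y), ?_⟩
  rw [← Finset.add_sum_erase _ _ hw]
  simp only [add_smul, Finset.sum_add_distrib, mul_smul, ← Finset.smul_sum]
  rw [← hbw]

/-- A finite family of directions in an open half-space is generated, as a cone, by those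
directions that are exposed rays. -/
theorem exists_generating_subset [FiniteDimensional ℝ E] (D : Finset E) (n₀ : E)
    (hn₀ : ∀ x ∈ D, inner ℝ n₀ x < 0) :
    ∃ W ⊆ D, (∀ x ∈ D, InCone W x) ∧
      ∀ w ∈ W, ∃ n : E, inner ℝ n w = 0 ∧ ∀ x ∈ D, (∀ t : ℝ, x ≠ t • w) → inner ℝ n x < 0 := by
  classical
  obtain ⟨W, hW, hmin⟩ := Finset.exists_min_image
    (D.powerset.filter fun W => ∀ x ∈ D, InCone W x) Finset.card
    ⟨D, by simpa using fun x hx => InCone.of_mem hx⟩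
  simp only [Finset.mem_filter, Finset.mem_powerset] at hW hmin
  obtain ⟨hWD, hgen⟩ := hW
  refine ⟨W, hWD, hgen, fun w hw => ?_⟩
  have hnc : ¬ InCone (W.erase w) w := fun hc => by
    have := hmin (W.erase w) ⟨(Finset.erase_subset _ _).trans hWD,
      fun x hx => InCone.erase hw hc (hgen x hx)⟩
    have := Finset.card_erase_lt_of_mem hw
    omega
  obtain ⟨n, hn, hneg⟩ := exists_orthogonal_inner_neg (W.erase w) (Submodule.span ℝ {w}) (by
    intro a ha hmem
    obtain ⟨t, ht⟩ := Submodule.mem_span_singleton.1 hmem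
    by_cases htp : 0 < t
    · exact absurd ⟨fun x => t⁻¹ * max (a x) 0, fun x => by positivity, by
        simp only [mul_smul, ← Finset.smul_sum]
        rw [Finset.sum_congr rfl fun x hx => by rw [max_eq_left (ha x hx)], ← ht, smul_smul,
          inv_mul_cancel₀ htp.ne', one_smul]⟩ hnc
    · have h1 : inner ℝ n₀ (∑ s ∈ W.erase w, a s • s) = t * inner ℝ n₀ w := by
        rw [← ht, inner_smul_right]
      rw [inner_sum] at h1
      simp only [inner_smul_right] at h1
      have hle : ∀ s ∈ W.erase w, a s * inner ℝ n₀ s ≤ 0 := fun s hs =>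
        mul_nonpos_of_nonneg_of_nonpos (ha s hs) (hn₀ s (hWD (Finset.mem_of_mem_erase hs))).le
      have hsum : ∑ s ∈ W.erase w, a s * inner ℝ n₀ s = 0 := by
        refine le_antisymm (Finset.sum_nonpos hle) ?_
        rw [h1]
        exact mul_nonneg_of_nonpos_of_nonpos (not_lt.1 htp) (hn₀ w (hWD hw)).le
      intro s hs
      have := (Finset.sum_eq_zero_iff_of_nonpos hle).1 hsum s hs
      exact (mul_eq_zero.1 this).resolve_right (hn₀ s (hWD (Finset.mem_of_mem_erase hs))).ne)
  refine ⟨n, hn w (Submodule.mem_span_singleton_self w), fun x hx hne => ?_⟩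
  obtain ⟨a, ha, rfl⟩ := hgen x hx
  have hnw := hn w (Submodule.mem_span_singleton_self w)
  rw [inner_sum, ← Finset.add_sum_erase _ _ hw]
  simp only [inner_smul_right, hnw, mul_zero, zero_add]
  have hle : ∀ s ∈ W.erase w, a s * inner ℝ n s ≤ 0 := fun s hs =>
    mul_nonpos_of_nonneg_of_nonpos (ha s) (hneg s hs).le
  refine lt_of_le_of_ne (Finset.sum_nonpos hle) fun h0 => hne (a w) ?_
  rw [← Finset.add_sum_erase _ _ hw, Finset.sum_eq_zero, add_zero]
  intro s hs
  have := (Finset.sum_eq_zero_iff_of_nonpos hle).1 h0 s hs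
  rw [(mul_eq_zero.1 this).resolve_right (hneg s hs).ne, zero_smul]

/-- Every point of `V` is an exposed point of the convex hull of `V`. -/
def AllExposed (V : Finset E) : Prop :=
  ∀ v ∈ V, ∃ n : E, ∀ x ∈ V, x ≠ v → inner ℝ n x < inner ℝ n v

/-- The segment from `v` to `w` is an edge of the convex hull of `V`. -/
def Adj (V : Finset E) (v w : E) : Prop :=
  v ∈ V ∧ w ∈ V ∧ v ≠ w ∧ ∃ n : E, inner ℝ n v = inner ℝ n w ∧
    ∀ x ∈ V, x ≠ v → x ≠ w → inner ℝ n x < inner ℝ n v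

theorem Adj.symm {V : Finset E} {v w : E} (h : Adj V v w) : Adj V w v := by
  obtain ⟨hv, hw, hne, n, hn, hlt⟩ := h
  exact ⟨hw, hv, hne.symm, n, hn.symm, fun x hx h1 h2 => hn ▸ hlt x hx h2 h1⟩

open Classical in
/-- The edge vectors of `V` at `v`. -/
def dirs (V : Finset E) (v : E) : Finset E :=
  (V.image (· - v)).filter fun u => Adj V v (v + u)

theorem mem_dirs {V : Finset E} {v u : E} : u ∈ dirs V v ↔ Adj V v (v + u) := by
  classical
  simp only [dirs, Finset.mem_filter, Finset.mem_image, and_iff_right_iff_imp]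
  exact fun h => ⟨v + u, h.2.1, by simp⟩

/-- The polytope lies in the cone spanned by the edges at a vertex. -/
theorem inCone_dirs [FiniteDimensional ℝ E] {V : Finset E} (hV : AllExposed V) {v x : E}
    (hv : v ∈ V) (hx : x ∈ V) : InCone (dirs V v) (x - v) := by
  classical
  by_cases hxv : x = v
  · exact ⟨0, by simp, by simp [hxv]⟩
  obtain ⟨n₀, hn₀⟩ := hV v hv
  obtain ⟨W, hWD, hgen, hexp⟩ := exists_generating_subset ((V.erase v).image (· - v)) n₀ (by
    intro y hy
    obtain ⟨z, hz, rfl⟩ := Finset.mem_image.1 hy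
    have := hn₀ z (Finset.mem_of_mem_erase hz) (Finset.ne_of_mem_erase hz)
    rw [inner_sub_right]
    linarith)
  have hsub : W ⊆ dirs V v := by
    intro w hw
    obtain ⟨n, hnw, hn⟩ := hexp w hw
    obtain ⟨z, hz, rfl⟩ := Finset.mem_image.1 (hWD hw)
    have hzv := Finset.ne_of_mem_erase hz
    have hzV := Finset.mem_of_mem_erase hz
    rw [mem_dirs, add_sub_cancel]
    rw [inner_sub_right] at hnw
    refine ⟨hv, hzV, hzv.symm, n, by linarith, fun y hy hyv hyz => ?_⟩
    have := hn (y - v) (Finset.mem_image_of_mem _ (Finset.mem_erase.2 ⟨hyv, hy⟩)) ?_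
    · rw [inner_sub_right] at this
      linarith
    intro t ht
    have hny := hn₀ y hy hyv
    have hnz := hn₀ z hzV hzv
    obtain ⟨m, hm⟩ := hV y hy
    obtain ⟨k, hk⟩ := hV z hzV
    have e0 := congrArg (inner ℝ n₀) ht
    have e1 := congrArg (inner ℝ m) ht
    have e2 := congrArg (inner ℝ k) ht
    simp only [inner_smul_right, inner_sub_right] at e0 e1 e2
    have := hm v hv (Ne.symm hyv)
    have := hm z hzV (Ne.symm hyz)
    have := hk v hv (Ne.symm hzv)
    have := hk y hy hyz
    have ht0 : 0 < t := by
      by_contra hneg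
      nlinarith
    rcases le_total t 1 with h | h <;> nlinarith
  obtain ⟨a, ha, he⟩ := hgen (x - v)
    (Finset.mem_image_of_mem _ (Finset.mem_erase.2 ⟨hxv, hx⟩))
  refine ⟨fun u => if u ∈ W then a u else 0, fun u => by dsimp only; split_ifs; exacts [ha u, le_rfl], ?_⟩
  rw [he, ← Finset.sum_subset hsub (fun u _ hu => by simp [hu])]
  exact Finset.sum_congr rfl fun u hu => by simp [hu]

/-- Points of a face lie in the cone spanned by the edges of the face at a vertex of it. -/
theorem exists_face_combination [FiniteDimensional ℝ E] {V : Finset E} (hV : AllExposed V)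
    {n v x : E} (hv : v ∈ V) (hx : x ∈ V) (hmax : ∀ y ∈ V, inner ℝ n y ≤ inner ℝ n v)
    (hnx : inner ℝ n x = inner ℝ n v) :
    ∃ a : E → ℝ, (∀ u, 0 ≤ a u) ∧ x - v = ∑ u ∈ dirs V v, a u • u ∧
      ∀ u ∈ dirs V v, inner ℝ n u ≠ 0 → a u = 0 := by
  obtain ⟨a, ha, he⟩ := inCone_dirs hV hv hx
  refine ⟨a, ha, he, fun u hu hnu => ?_⟩
  have h0 : ∑ u ∈ dirs V v, a u * inner ℝ n u = 0 := by
    have := congrArg (inner ℝ n) he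
    rw [inner_sub_right, hnx, sub_self, inner_sum] at this
    simp only [inner_smul_right] at this
    exact this.symm
  have hle : ∀ u ∈ dirs V v, a u * inner ℝ n u ≤ 0 := fun u hu => by
    have := hmax _ (mem_dirs.1 hu).2.1
    rw [inner_add_right] at this
    exact mul_nonpos_of_nonneg_of_nonpos (ha u) (by linarith)
  exact (mul_eq_zero.1 ((Finset.sum_eq_zero_iff_of_nonpos hle).1 h0 u hu)).resolve_right hnu

/-- A functional that is nonpositive on all edges at `v` attains its maximum at `v`. -/
theorem inner_le_of_dirs [FiniteDimensional ℝ E] {V : Finset E} (hV : AllExposed V)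
    {n v : E} (hv : v ∈ V) (hn : ∀ u ∈ dirs V v, inner ℝ n u ≤ 0) :
    ∀ y ∈ V, inner ℝ n y ≤ inner ℝ n v := by
  intro y hy
  obtain ⟨a, ha, he⟩ := inCone_dirs hV hv hy
  have := congrArg (inner ℝ n) he
  rw [inner_sub_right, inner_sum] at this
  have hle : ∑ u ∈ dirs V v, inner ℝ n (a u • u) ≤ 0 := Finset.sum_nonpos fun u hu => by
    rw [inner_smul_right]
    exact mul_nonpos_of_nonneg_of_nonpos (ha u) (hn u hu)
  linarith

/-- The edge graph is connected. -/
theorem subset_of_adj_closed [FiniteDimensional ℝ E] {V : Finset E} (hV : AllExposed V)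
    {G : E → Prop} {v : E} (hv : v ∈ V) (hGv : G v) (hG : ∀ x y, G x → Adj V x y → G y) :
    ∀ x ∈ V, G x := by
  classical
  intro x hx
  by_contra hGx
  obtain ⟨n, hn⟩ := hV x hx
  obtain ⟨s, hs, hmax⟩ := Finset.exists_max_image (V.filter G) (inner ℝ n) ⟨v, by simp [hv, hGv]⟩
  simp only [Finset.mem_filter] at hs hmax
  have hsx : s ≠ x := fun h => hGx (h ▸ hs.2)
  have := hn s hs.1 hsx
  have := inner_le_of_dirs hV hs.1 (n := n) (fun u hu => by
    have hadj := mem_dirs.1 hu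
    have := hmax (s + u) ⟨hadj.2.1, hG s _ hs.2 hadj⟩
    rw [inner_add_right] at this
    linarith) x hx
  linarith

end Polytope

section Planar

/-- A chord of a circle of radius `M` at distance `k` from the centre subtends a half angle of at
most `π / 3`, if some point of the circle above the chord, at signed height `Y`, is on the inner
side of the reflected chords through its ends. Here `d` is the distance of the point from the axis
of symmetry, in units of half the chord. -/
theorem le_two_mul_of_circle {M k Y d : ℝ} (hk : 0 < k) (hkM : k < M) (hY : -k < Y) (hYM : Y ≤ M)
    (hd : 0 ≤ d) (hcirc : (M ^ 2 - k ^ 2) * d ^ 2 = M ^ 2 - Y ^ 2)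
    (hdist : Y * (M ^ 2 - 2 * k ^ 2) + 2 * k * (M ^ 2 - k ^ 2) * d ≤ k * M ^ 2) : M ≤ 2 * k := by
  have hM : 0 < M := hk.trans hkM
  have h1 : M - Y ≤ d * (M + k) := by
    refine (sq_le_sq₀ (by linarith) (by positivity)).1 ?_
    have : (M - k) * (M - Y) ^ 2 ≤ (M - k) * (d * (M + k)) ^ 2 := by
      have e : (M - k) * (d * (M + k)) ^ 2 = (M + k) * (M ^ 2 - Y ^ 2) := by
        rw [← hcirc]; ring
      rw [e]
      nlinarith [mul_nonneg (mul_nonneg hM.le (sub_nonneg.2 hYM)) (by linarith : 0 ≤ Y + k)]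
    exact le_of_mul_le_mul_left this (by linarith)
  have h2 : (M - k) * (M - Y) ≤ (M ^ 2 - k ^ 2) * d := by
    have := mul_le_mul_of_nonneg_left h1 (by linarith : 0 ≤ M - k)
    linarith
  have h3 : M * (Y + k) * (M - 2 * k) ≤ 0 := by
    have := mul_le_mul_of_nonneg_left h2 (by linarith : 0 ≤ 2 * k)
    nlinarith
  by_contra hcon
  have : 0 < M * (Y + k) * (M - 2 * k) := mul_pos (mul_pos hM (by linarith)) (by linarith)
  linarith

variable {p q κ : ℝ}

theorem discr_pos (hp : 0 < p) (hq : 0 < q) (h1 : -1 < κ) (h2 : κ < 1) :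
    0 < p ^ 2 + q ^ 2 - κ * (p - q) * (p + q) := by
  have : p ^ 2 + q ^ 2 - κ * (p - q) * (p + q) = p ^ 2 * (1 - κ) + q ^ 2 * (1 + κ) := by ring
  rw [this]
  have := mul_pos (pow_pos hp 2) (sub_pos.2 h2)
  have := mul_pos (pow_pos hq 2) (by linarith : 0 < 1 + κ)
  linarith

/-- The vertex of an equilateral polygon with alternating radii following a given edge. -/
theorem next_vertex_coords (hp : 0 < p) (hq : 0 < q) (hpq : p + q = 1) (h1 : -1 < κ) (h2 : κ < 1)
    {a b : ℝ} (hc : a ^ 2 + b ^ 2 - 2 * a * b * κ = 2 * q * (a + b))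
    (hu : (a - 1) ^ 2 + b ^ 2 - 2 * (a - 1) * b * κ = 1) (h0 : ¬ (a = 0 ∧ b = 0)) :
    a * p = b * (q + κ) ∧ b * (p ^ 2 + q ^ 2 - κ * (p - q)) = 2 * p * q ∧ 0 < b := by
  obtain rfl : p = 1 - q := by linarith
  have hD := discr_pos hp hq h1 h2
  have hlin : a * (1 - q) = b * (q + κ) := by linarith
  have hb : b ≠ 0 := by
    rintro rfl
    have : a = 0 := by
      have : a * (1 - q) = 0 := by linarith
      exact (mul_eq_zero.1 this).resolve_right hp.ne'
    exact h0 ⟨this, rfl⟩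
  have hbD : b * ((1 - q) ^ 2 + q ^ 2 - κ * ((1 - q) - q)) = 2 * (1 - q) * q := by
    have e : b * (1 + κ) * (b * ((1 - q) ^ 2 + q ^ 2 - κ * ((1 - q) - q)) - 2 * (1 - q) * q) = 0 := by
      have e1 : (1 - q) ^ 2 * (a ^ 2 + b ^ 2 - 2 * a * b * κ - 2 * q * (a + b))
          = (a * (1 - q)) ^ 2 + b ^ 2 * (1 - q) ^ 2 - 2 * (a * (1 - q)) * b * κ * (1 - q)
            - 2 * q * (a * (1 - q) + b * (1 - q)) * (1 - q) := by ring
      rw [hc, sub_self, mul_zero, hlin] at e1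
      linear_combination -e1
    have hne : b * (1 + κ) ≠ 0 := mul_ne_zero hb (by linarith)
    linarith [(mul_eq_zero.1 e).resolve_left hne]
  refine ⟨hlin, hbD, ?_⟩
  by_contra hneg
  have hD' : 0 < (1 - q) ^ 2 + q ^ 2 - κ * ((1 - q) - q) := by
    have : (1 - q) + q = 1 := by ring
    rw [this, mul_one] at hD
    exact hD
  have : 0 < 2 * (1 - q) * q := by positivity
  nlinarith

set_option maxHeartbeats 800000 in
/-- If an equilateral polygon with alternating radii, in the coordinates given by the two edges
at a vertex, has a further vertex `(s, r)` on the far side of the two neighbours, then the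
cosine `-κ` of the angle between these edges is at most `-1 / 2`. -/
theorem half_le_of_third_vertex (hq : 0 < q) (hpq : p + q = 1) (hqp : q ≤ p)
    (h2 : κ < 1) (hκ : p - q < κ)
    {a b s r : ℝ} (hab : a * p = b * (q + κ))
    (hb : b * (p ^ 2 + q ^ 2 - κ * (p - q)) = 2 * p * q)
    (hy : s ^ 2 + r ^ 2 - 2 * s * r * κ = 2 * q * (s + r) + (p - q))
    (hv : 1 ≤ s + r) (hs : ¬ (s = 1 ∧ r = 0)) (hr : ¬ (s = 0 ∧ r = 1))
    (hd1 : q * (s + r + a + b - 1) ≥ s * a + r * b - κ * (s * b + r * a))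
    (hd2 : q * (s + r + a + b - 1) ≥ s * b + r * a - κ * (s * a + r * b)) : 1 / 2 ≤ κ := by
  have hx : 0 < 1 - κ := by linarith
  have hz : 0 < 1 + κ := by linarith
  have hx' := hx.ne'
  obtain rfl : p = 1 - q := by linarith
  set σ := 2 * q / (1 - κ) with hσ
  have hσx : σ * (1 - κ) = 2 * q := by rw [hσ]; field_simp
  set k := σ - 1 with hk
  have hkx : k * (1 - κ) = κ - (1 - q - q) := by rw [hk, sub_mul, hσx]; ring
  have hk0 : 0 < k := by
    by_contra h
    nlinarith
  have hσ0 : 0 < σ := by positivity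
  set m := k ^ 2 + (1 + κ) / (1 - κ) with hm
  have hmk : (m - k ^ 2) * (1 - κ) = 1 + κ := by rw [hm]; field_simp; ring
  have hmk' : k ^ 2 < m := by rw [hm]; linarith [div_pos hz hx]
  have hm0 : 0 < m := lt_of_le_of_lt (sq_nonneg k) hmk'
  have hmD : m * (1 - κ) ^ 2 = 2 * ((1 - q) ^ 2 + q ^ 2 - κ * (1 - q - q)) := by
    have : m * (1 - κ) ^ 2 = (m - k ^ 2) * (1 - κ) * (1 - κ) + (k * (1 - κ)) ^ 2 := by ring
    rw [this, hmk, hkx]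
    ring
  have hA : (a + b) * ((1 - q) ^ 2 + q ^ 2 - κ * (1 - q - q)) = 2 * q * (1 + κ) := by
    have h : (1 - q) * ((a + b) * ((1 - q) ^ 2 + q ^ 2 - κ * (1 - q - q))) =
        (1 - q) * (2 * q * (1 + κ)) := by
      linear_combination ((1 - q) ^ 2 + q ^ 2 - κ * (1 - q - q)) * hab + (1 + κ) * hb
    exact mul_left_cancel₀ (by linarith) h
  have hB : (a - b) * ((1 - q) ^ 2 + q ^ 2 - κ * (1 - q - q)) = 2 * q * (k * (1 - κ)) := by
    have h : (1 - q) * ((a - b) * ((1 - q) ^ 2 + q ^ 2 - κ * (1 - q - q))) =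
        (1 - q) * (2 * q * (k * (1 - κ))) := by
      rw [hkx]
      linear_combination ((1 - q) ^ 2 + q ^ 2 - κ * (1 - q - q)) * hab + (κ - (1 - q - q)) * hb
    exact mul_left_cancel₀ (by linarith) h
  have hAm : (a + b - σ) * m = σ * (m - 2 * k ^ 2) := by
    have h : (1 - κ) ^ 2 * ((a + b) * m) = (1 - κ) ^ 2 * (2 * σ * (m - k ^ 2)) := by
      have e1 : (1 - κ) ^ 2 * ((a + b) * m) = (a + b) * (m * (1 - κ) ^ 2) := by ring
      have e2 : (1 - κ) ^ 2 * (2 * σ * (m - k ^ 2)) =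
        2 * (σ * (1 - κ)) * ((m - k ^ 2) * (1 - κ)) := by ring
      rw [e1, e2, hσx, hmk, hmD]
      linear_combination 2 * hA
    have := mul_left_cancel₀ (by positivity) h
    linear_combination this
  have hBm : (a - b) * m = 2 * σ * k := by
    have h : (1 - κ) ^ 2 * ((a - b) * m) = (1 - κ) ^ 2 * (2 * σ * k) := by
      have e1 : (1 - κ) ^ 2 * ((a - b) * m) = (a - b) * (m * (1 - κ) ^ 2) := by ring
      have e2 : (1 - κ) ^ 2 * (2 * σ * k) = 2 * (σ * (1 - κ)) * (k * (1 - κ)) := by ring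
      rw [e1, e2, hσx, hmD]
      linear_combination 2 * hB
    exact mul_left_cancel₀ (by positivity) h
  have hcirc : (m - k ^ 2) * (s - r) ^ 2 = m - (s + r - σ) ^ 2 := by
    have h : (1 - κ) ^ 2 * ((m - k ^ 2) * (s - r) ^ 2) = (1 - κ) ^ 2 * (m - (s + r - σ) ^ 2) := by
      have e1 : (1 - κ) ^ 2 * ((m - k ^ 2) * (s - r) ^ 2) =
        ((m - k ^ 2) * (1 - κ)) * (1 - κ) * (s - r) ^ 2 := by ring
      have e2 : (1 - κ) ^ 2 * (m - (s + r - σ) ^ 2) =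
        m * (1 - κ) ^ 2 - ((s + r) * (1 - κ) - σ * (1 - κ)) ^ 2 := by ring
      rw [e1, e2, hσx, hmk, hmD]
      linear_combination 2 * (1 - κ) * hy
    exact mul_left_cancel₀ (by positivity) h
  have key : ∀ t : ℝ, (1 - κ) * ((s + r) * (a + b)) + (1 + κ) * (t * (a - b)) ≤
      2 * q * (s + r + a + b - 1) →
      (s + r - σ) * (m - 2 * k ^ 2) + 2 * k * (m - k ^ 2) * t ≤ k * m := by
    intro t ht
    have h1 : (σ * (1 - κ)) * ((s + r - σ) * (m - 2 * k ^ 2) + 2 * k * (m - k ^ 2) * t) =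
        m * ((1 - κ) * ((s + r) * (a + b)) + (1 + κ) * (t * (a - b))
          - 2 * q * (s + r + a + b - 1)) + (σ * (1 - κ)) * (k * m) := by
      rw [← hσx, ← hmk]
      linear_combination (-(1 - κ) * (s + r - σ)) * hAm - ((m - k ^ 2) * (1 - κ) * t) * hBm
        - (σ * (1 - κ) * m) * hk
    have h2 : m * ((1 - κ) * ((s + r) * (a + b)) + (1 + κ) * (t * (a - b))
          - 2 * q * (s + r + a + b - 1)) ≤ 0 :=
      mul_nonpos_of_nonneg_of_nonpos hm0.le (by linarith)
    exact le_of_mul_le_mul_left (by linarith) (mul_pos hσ0 hx)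
  have k1 := key (s - r) (by linarith)
  have k2 := key (-(s - r)) (by linarith)
  have hM2 : Real.sqrt m ^ 2 = m := Real.sq_sqrt hm0.le
  have hkM : k < Real.sqrt m := (Real.lt_sqrt hk0.le).2 hmk'
  have hYk : -k < s + r - σ := by
    refine lt_of_le_of_ne (by linarith) fun he => ?_
    have hs1 : r = 1 - s := by linarith
    subst hs1
    have h0 : (1 + κ) * (s * (1 - s)) = 0 := by linarith
    rcases mul_eq_zero.1 ((mul_eq_zero.1 h0).resolve_left hz.ne') with h | h
    · exact hr ⟨h, by linarith⟩
    · exact hs ⟨by linarith, h⟩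
  have hYM : s + r - σ ≤ Real.sqrt m := by
    apply Real.le_sqrt_of_sq_le
    have := mul_nonneg (sub_pos.2 hmk').le (sq_nonneg (s - r))
    linarith
  have := le_two_mul_of_circle (d := |s - r|) hk0 hkM hYk hYM (abs_nonneg _)
    (by rw [sq_abs, hM2, hcirc]) (by
      rw [hM2]
      rcases abs_choice (s - r) with h | h <;> rw [h] <;> assumption)
  have hm4 : m ≤ 4 * k ^ 2 := by
    calc m = Real.sqrt m ^ 2 := hM2.symm
      _ ≤ (2 * k) ^ 2 := pow_le_pow_left₀ (Real.sqrt_nonneg m) this 2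
      _ = 4 * k ^ 2 := by ring
  have h3 : (1 + κ) * (1 - κ) ≤ 3 * (κ - (1 - q - q)) ^ 2 := by
    rw [← hkx, ← hmk]
    linarith [mul_le_mul_of_nonneg_right hm4 (sq_nonneg (1 - κ))]
  have h4 : (κ - (1 - q - q)) ^ 2 ≤ κ ^ 2 := by
    apply pow_le_pow_left₀ <;> linarith
  by_contra hlt
  have h5 : κ ^ 2 < (1 / 2) ^ 2 := pow_lt_pow_left₀ (not_le.1 hlt) (by linarith) two_ne_zero
  linarith

end Planar

section Bipartite

variable {E : Type*} [NormedAddCommGroup E] [InnerProductSpace ℝ E]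

theorem AllExposed.one_le_sum {V : Finset E} (hV : AllExposed V) {v x : E} (hv : v ∈ V)
    (hx : x ∈ V) (hxv : x ≠ v) {S : Finset E} (hS : ∀ u ∈ S, v + u ∈ V) {a : E → ℝ}
    (ha : ∀ u, 0 ≤ a u) (he : x - v = ∑ u ∈ S, a u • u) : 1 ≤ ∑ u ∈ S, a u := by
  by_contra! hlt
  obtain ⟨n, hn⟩ := hV x hx
  have h1 : ∑ u ∈ S, a u * inner ℝ n u ≤ ∑ u ∈ S, a u * (inner ℝ n x - inner ℝ n v) := by
    refine Finset.sum_le_sum fun u hu => mul_le_mul_of_nonneg_left ?_ (ha u)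
    have : inner ℝ n (v + u) ≤ inner ℝ n x := by
      by_cases h : v + u = x
      · rw [h]
      · exact (hn _ (hS u hu) h).le
    rw [inner_add_right] at this
    linarith
  have h2 := congrArg (inner ℝ n) he
  rw [inner_sub_right, inner_sum] at h2
  simp only [inner_smul_right] at h2
  rw [← Finset.sum_mul] at h1
  have := hn v hv hxv.symm
  nlinarith

theorem inner_lt_one {x y : E} (hx : inner ℝ x x = 1) (hy : inner ℝ y y = 1)
    (hxy : x ≠ y) : inner ℝ x y < 1 := by
  have : 0 < inner ℝ (x - y) (x - y) :=
    lt_of_le_of_ne real_inner_self_nonneg fun h => hxy (sub_eq_zero.1 (inner_self_eq_zero.1 h.symm))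
  rw [inner_sub_left, inner_sub_right, inner_sub_right, hx, hy, real_inner_comm x y] at this
  linarith

theorem neg_one_lt_inner {x y : E} (hx : inner ℝ x x = 1) (hy : inner ℝ y y = 1)
    (hxy : x ≠ -y) : -1 < inner ℝ x y := by
  have := inner_lt_one hx (by simpa using hy) hxy
  rw [inner_neg_right] at this
  linarith

/-- The edge vectors `u`, `u'` at `v` span a two-dimensional face, cut out by `n`. -/
structure IsFlag (V : Finset E) (v u u' n : E) : Prop where
  mem : u ∈ dirs V v
  mem' : u' ∈ dirs V v
  ne : u ≠ u'
  inner_eq : inner ℝ n u = 0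
  inner_eq' : inner ℝ n u' = 0
  inner_neg : ∀ x ∈ dirs V v, x ≠ u → x ≠ u' → inner ℝ n x < 0

theorem IsFlag.symm {V : Finset E} {v u u' n : E} (h : IsFlag V v u u' n) : IsFlag V v u' u n :=
  ⟨h.mem', h.mem, h.ne.symm, h.inner_eq', h.inner_eq, fun x hx h1 h2 => h.inner_neg x hx h2 h1⟩

/-- A bound on the inner products of edge vectors spanning a two-dimensional face extends to all
pairs of edge vectors. -/
theorem inner_le_of_isFlag [FiniteDimensional ℝ E] {V : Finset E} {v : E} {c : ℝ} (hc : 0 < c)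
    (hvu : ∀ u ∈ dirs V v, inner ℝ v u = -c) (huu : ∀ u ∈ dirs V v, inner ℝ u u = 1)
    {e e' : E} (he : e ∈ dirs V v) (he' : e' ∈ dirs V v) (hne : e ≠ e') {t : ℝ} (ht : t ≤ 1)
    (h : ∀ u n, IsFlag V v e u n → inner ℝ e u ≤ t) : inner ℝ e e' ≤ t := by
  have hD : AllExposed (dirs V v) := fun u hu =>
    ⟨u, fun x hx hxu => by rw [huu u hu]; exact inner_lt_one (huu u hu) (huu x hx) hxu.symm⟩
  obtain ⟨a, ha, hsum⟩ := inCone_dirs hD he he'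
  have hmem : ∀ y ∈ dirs (dirs V v) e, e + y ∈ dirs V v := fun y hy => (mem_dirs.1 hy).2.1
  have h1 := hD.one_le_sum he he' hne.symm hmem ha hsum
  have h2 := congrArg (inner ℝ e) hsum
  rw [inner_sub_right, inner_sum, huu e he] at h2
  simp only [inner_smul_right] at h2
  have h3 : ∑ y ∈ dirs (dirs V v) e, a y * inner ℝ e y ≤
      ∑ y ∈ dirs (dirs V v) e, a y * (t - 1) := by
    refine Finset.sum_le_sum fun y hy => mul_le_mul_of_nonneg_left ?_ (ha y)
    obtain ⟨-, hmy, hney, n, hn, hlt⟩ := mem_dirs.1 hy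
    have hs : ∀ x ∈ dirs V v, inner ℝ (n + (inner ℝ n e / c) • v) x = inner ℝ n x - inner ℝ n e :=
      fun x hx => by
        rw [inner_add_left, real_inner_smul_left, hvu x hx]
        field_simp
        ring
    have := h (e + y) (n + (inner ℝ n e / c) • v) ⟨he, hmy, hney, by rw [hs e he, sub_self],
      by rw [hs _ hmy, hn, sub_self], fun x hx hx1 hx2 => by
        rw [hs x hx]
        linarith [hlt x hx hx1 hx2]⟩
    rw [inner_add_right, huu e he] at this
    linarith
  rw [← Finset.sum_mul] at h3
  nlinarith

theorem IsFlag.le [FiniteDimensional ℝ E] {V : Finset E} (hV : AllExposed V) {v u u' n : E}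
    (h : IsFlag V v u u' n) : ∀ y ∈ V, inner ℝ n y ≤ inner ℝ n v :=
  inner_le_of_dirs hV (mem_dirs.1 h.mem).1 fun x hx => by
    by_cases h1 : x = u
    · rw [h1, h.inner_eq]
    by_cases h2 : x = u'
    · rw [h2, h.inner_eq']
    exact (h.inner_neg x hx h1 h2).le

theorem IsFlag.exists_eq [FiniteDimensional ℝ E] {V : Finset E} (hV : AllExposed V) {v u u' n : E}
    (h : IsFlag V v u u' n) {y : E} (hy : y ∈ V) (hny : inner ℝ n y = inner ℝ n v) :
    ∃ a b : ℝ, 0 ≤ a ∧ 0 ≤ b ∧ y = v + (a • u + b • u') := by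
  classical
  obtain ⟨a, ha, hs, h0⟩ := exists_face_combination hV (mem_dirs.1 h.mem).1 hy (h.le hV) hny
  refine ⟨a u, a u', ha u, ha u', ?_⟩
  rw [← Finset.sum_pair (f := fun x => a x • x) h.ne, Finset.sum_subset
    (Finset.insert_subset h.mem (Finset.singleton_subset_iff.2 h.mem')), ← hs, add_sub_cancel]
  intro x hx hx'
  simp only [Finset.mem_insert, Finset.mem_singleton, not_or] at hx'
  rw [h0 x hx (h.inner_neg x hx hx'.1 hx'.2).ne, zero_smul]

theorem exists_face_dir [FiniteDimensional ℝ E] {V : Finset E} (hV : AllExposed V)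
    {n y z e : E} (hy : y ∈ V) (hz : z ∈ V) (hmax : ∀ x ∈ V, inner ℝ n x ≤ inner ℝ n y)
    (hnz : inner ℝ n z = inner ℝ n y) (he : ∀ t : ℝ, z - y ≠ t • e) :
    ∃ x ∈ dirs V y, x ≠ e ∧ inner ℝ n x = 0 := by
  classical
  by_contra! hcon
  obtain ⟨a, ha, hs, h0⟩ := exists_face_combination hV hy hz hmax hnz
  have hz : ∀ x ∈ dirs V y, x ≠ e → a x • x = 0 := fun x hx hxe => by
    rw [h0 x hx (hcon x hx hxe), zero_smul]
  by_cases hm : e ∈ dirs V y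
  · exact he (a e) (by rw [hs, Finset.sum_eq_single_of_mem e hm hz])
  · refine he 0 ?_
    rw [hs, zero_smul]
    exact Finset.sum_eq_zero fun x hx => hz x hx fun h => hm (h ▸ hx)

/-- The vertex set of an equilateral polytope with bipartite edge graph, whose vertices lie on
two concentric spheres according to their class. -/
structure Bip (V : Finset E) (A B : Set E) (p q R : ℝ) : Prop where
  mem_iff : ∀ x, x ∈ V ↔ x ∈ A ∨ x ∈ B
  notMem : ∀ x ∈ A, x ∉ B
  exposed : AllExposed V
  adjA : ∀ v w, Adj V v w → v ∈ A → w ∈ B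
  adjB : ∀ v w, Adj V v w → v ∈ B → w ∈ A
  inner_self : ∀ v, ∀ u ∈ dirs V v, inner ℝ u u = 1
  innerA : ∀ v ∈ A, ∀ u ∈ dirs V v, inner ℝ v u = -p
  innerB : ∀ v ∈ B, ∀ u ∈ dirs V v, inner ℝ v u = -q
  hp : 0 < p
  hq : 0 < q
  hpq : p + q = 1
  sqA : ∀ a ∈ A, inner ℝ a a = R + p
  sqB : ∀ b ∈ B, inner ℝ b b = R + q

namespace Bip

variable {V : Finset E} {A B : Set E} {p q R : ℝ}

theorem swap (h : Bip V A B p q R) : Bip V B A q p R where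
  mem_iff x := by rw [h.mem_iff, or_comm]
  notMem x hx hx' := h.notMem x hx' hx
  exposed := h.exposed
  adjA := h.adjB
  adjB := h.adjA
  inner_self := h.inner_self
  innerA := h.innerB
  innerB := h.innerA
  hp := h.hq
  hq := h.hp
  hpq := by rw [add_comm, h.hpq]
  sqA := h.sqB
  sqB := h.sqA

theorem memB (h : Bip V A B p q R) {v : E} (hv : v ∈ B) : v ∈ V := (h.mem_iff v).2 (Or.inr hv)

theorem add_memA (h : Bip V A B p q R) {v u : E} (hv : v ∈ B) (hu : u ∈ dirs V v) : v + u ∈ A :=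
  h.adjB v _ (mem_dirs.1 hu) hv

theorem neg_mem_dirs {v u : E} (hu : u ∈ dirs V v) : -u ∈ dirs V (v + u) := by
  rw [mem_dirs, add_neg_cancel_right]
  exact (mem_dirs.1 hu).symm

theorem inner_le [FiniteDimensional ℝ E] (h : Bip V A B p q R) {v x : E} (hv : v ∈ B) (hx : x ∈ V)
    (hxv : x ≠ v) : inner ℝ v x ≤ inner ℝ v v - q := by
  obtain ⟨a, ha, hs⟩ := inCone_dirs h.exposed (h.memB hv) hx
  have h1 := h.exposed.one_le_sum (h.memB hv) hx hxv (fun u hu => (mem_dirs.1 hu).2.1) ha hs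
  have h2 := congrArg (inner ℝ v) hs
  rw [inner_sub_right, inner_sum, Finset.sum_congr rfl fun u hu => by
    rw [inner_smul_right, h.innerB v hv u hu], ← Finset.sum_mul] at h2
  nlinarith [h.hq]

theorem ne_neg (h : Bip V A B p q R) {v u u' : E} (hv : v ∈ B) (hu : u ∈ dirs V v)
    (hu' : u' ∈ dirs V v) : u ≠ -u' := fun he => by
  have := h.innerB v hv u hu
  rw [he, inner_neg_right, h.innerB v hv u' hu'] at this
  linarith [h.hq]

theorem inner_lt_one (h : Bip V A B p q R) {v u u' : E} (hu : u ∈ dirs V v)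
    (hu' : u' ∈ dirs V v) (hne : u ≠ u') : inner ℝ u u' < 1 :=
  _root_.inner_lt_one (h.inner_self v u hu) (h.inner_self v u' hu') hne

theorem neg_one_lt_inner (h : Bip V A B p q R) {v u u' : E} (hv : v ∈ B) (hu : u ∈ dirs V v)
    (hu' : u' ∈ dirs V v) : -1 < inner ℝ u u' :=
  _root_.neg_one_lt_inner (h.inner_self v u hu) (h.inner_self v u' hu') (h.ne_neg hv hu hu')

theorem inner_add_comb (h : Bip V A B p q R) {v u u' : E} (hv : v ∈ B) (hu : u ∈ dirs V v)
    (hu' : u' ∈ dirs V v) (s r a b : ℝ) :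
    inner ℝ (v + (s • u + r • u')) (v + (a • u + b • u')) = R + q - q * (s + r + a + b) +
      s * a + r * b + (s * b + r * a) * inner ℝ u u' := by
  have h1 := h.innerB v hv u hu
  have h2 := h.innerB v hv u' hu'
  have h3 := real_inner_comm u u'
  simp only [inner_add_left, inner_add_right, real_inner_smul_left, real_inner_smul_right, h1, h2,
    real_inner_comm v, h.inner_self v u hu, h.inner_self v u' hu', h.sqB v hv, h3]
  ring

theorem comb_inj (h : Bip V A B p q R) {v u u' : E} (hv : v ∈ B) (hu : u ∈ dirs V v)
    (hu' : u' ∈ dirs V v) (hne : u ≠ u') {s r a b : ℝ} (he : s • u + r • u' = a • u + b • u') :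
    s = a ∧ r = b := by
  have e1 := congrArg (inner ℝ v) he
  have e2 := congrArg (inner ℝ u) he
  simp only [inner_add_right, real_inner_smul_right, h.innerB v hv u hu, h.innerB v hv u' hu',
    h.inner_self v u hu] at e1 e2
  have e3 : s + r = a + b := by
    have : q * (s + r) = q * (a + b) := by linarith
    exact mul_left_cancel₀ h.hq.ne' this
  have e4 : (r - b) * (1 - inner ℝ u u') = 0 := by
    linear_combination e3 - e2
  have e5 : r = b := by
    have := h.inner_lt_one hu hu' hne
    rcases mul_eq_zero.1 e4 with h | h <;> linarith
  exact ⟨by linarith, e5⟩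

/-- The vertex of a two-dimensional face following a given edge. -/
theorem next_vertex [FiniteDimensional ℝ E] (h : Bip V A B p q R) {v u u' n : E} (hv : v ∈ B)
    (hf : IsFlag V v u u' n) : ∃ x ∈ dirs V (v + u), ∃ α β : ℝ, inner ℝ n x = 0 ∧ 0 ≤ α ∧ 0 < β ∧
      u + x = α • u + β • u' ∧ α * p = β * (q - inner ℝ u u') ∧
      β * (p ^ 2 + q ^ 2 + inner ℝ u u' * (p - q)) = 2 * p * q := by
  have hw := h.add_memA hv hf.mem
  have hnw : inner ℝ n (v + u) = inner ℝ n v := by rw [inner_add_right, hf.inner_eq, add_zero]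
  obtain ⟨x, hx, hxu, hnx⟩ := exists_face_dir h.exposed (e := -u) (mem_dirs.1 hf.mem).2.1
    (mem_dirs.1 hf.mem').2.1 (by rw [hnw]; exact hf.le h.exposed)
    (by rw [hnw, inner_add_right, hf.inner_eq', add_zero]) (fun t ht => by
      have : (0 : ℝ) • u + (1 : ℝ) • u' = (1 - t) • u + (0 : ℝ) • u' := by
        rw [add_sub_add_left_eq_sub, sub_eq_iff_eq_add] at ht
        rw [ht]
        module
      exact one_ne_zero (h.comb_inj hv hf.mem hf.mem' hf.ne this).2)
  have hz := h.swap.add_memA hw hx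
  obtain ⟨α, β, hα, hβ, he⟩ := hf.exists_eq h.exposed (h.memB hz)
    (by rw [inner_add_right, hnx, hnw, add_zero])
  have he' : u + x = α • u + β • u' := by rwa [add_assoc, add_right_inj] at he
  have hxe : x = (α - 1) • u + β • u' := by
    rw [← add_right_inj u, he']
    module
  have h1 := h.sqB _ hz
  rw [he, h.inner_add_comb hv hf.mem hf.mem'] at h1
  have h2 := h.inner_self _ x hx
  rw [hxe] at h2
  simp only [inner_add_left, inner_add_right, real_inner_smul_left, real_inner_smul_right,
    real_inner_comm u u', h.inner_self v u hf.mem, h.inner_self v u' hf.mem'] at h2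
  obtain ⟨h3, h4, h5⟩ := next_vertex_coords (κ := -inner ℝ u u') (a := α) (b := β) h.hp h.hq h.hpq
    (by linarith [h.inner_lt_one hf.mem hf.mem' hf.ne])
    (by linarith [h.neg_one_lt_inner hv hf.mem hf.mem']) (by linarith) (by linarith) (by
      rintro ⟨rfl, rfl⟩
      rw [zero_smul, zero_smul, zero_add, add_comm] at he'
      exact hxu (eq_neg_of_add_eq_zero_left he'))
  exact ⟨x, hx, α, β, hnx, hα, h5, he', by linarith, by linarith⟩

theorem isFlag_inner_le [FiniteDimensional ℝ E] (h : Bip V A B p q R) {v u u' n : E} (hv : v ∈ B)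
    (hf : IsFlag V v u u' n) : inner ℝ u u' ≤ q - p := by
  obtain ⟨x, hx, α, β, hnx, hα, hβ, he, h1, -⟩ := h.next_vertex hv hf
  have hz := h.swap.add_memA (h.add_memA hv hf.mem) hx
  rw [add_assoc, he] at hz
  have hw := h.add_memA hv hf.mem'
  have h2 := h.inner_le hz ((h.mem_iff _).2 (Or.inl hw)) (fun hc => h.notMem _ hw (hc ▸ hz))
  rw [h.sqB _ hz] at h2
  have h3 := h.inner_add_comb hv hf.mem hf.mem' α β 0 1
  rw [zero_smul, one_smul, zero_add] at h3
  rw [h3] at h2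
  have h4 : β * p ≤ α * (q - inner ℝ u u') := by
    obtain rfl : p = 1 - q := by linarith [h.hpq]
    linarith
  have hp := h.hp
  have h5 : 0 ≤ q - inner ℝ u u' := by
    have : 0 ≤ β * (q - inner ℝ u u') := h1 ▸ mul_nonneg hα hp.le
    exact nonneg_of_mul_nonneg_right this hβ
  have h6 : p ^ 2 ≤ (q - inner ℝ u u') ^ 2 := by
    have : β * p ^ 2 ≤ β * (q - inner ℝ u u') ^ 2 := by
      have := mul_le_mul_of_nonneg_right h4 hp.le
      calc β * p ^ 2 = β * p * p := by ring
        _ ≤ α * (q - inner ℝ u u') * p := this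
        _ = α * p * (q - inner ℝ u u') := by ring
        _ = _ := by rw [h1]; ring
    exact le_of_mul_le_mul_left this hβ
  have := (sq_le_sq₀ hp.le h5).1 h6
  linarith

theorem inner_dirs_le [FiniteDimensional ℝ E] (h : Bip V A B p q R) {v u u' : E} (hv : v ∈ B)
    (hu : u ∈ dirs V v) (hu' : u' ∈ dirs V v) (hne : u ≠ u') : inner ℝ u u' ≤ q - p :=
  inner_le_of_isFlag h.hq (h.innerB v hv) (h.inner_self v) hu hu' hne
    (by linarith [h.hp, h.hpq]) fun _ _ hf => h.isFlag_inner_le hv hf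

/-- A face at which the extremal angle occurs is a rhombus. -/
theorem mem_dirs_of_inner_eq [FiniteDimensional ℝ E] (h : Bip V A B p q R) {v u u' n : E}
    (hv : v ∈ B) (hf : IsFlag V v u u' n) (he : inner ℝ u u' = q - p) : u' ∈ dirs V (v + u) := by
  obtain ⟨x, hx, α, β, hnx, hα, hβ, hux, h1, h2⟩ := h.next_vertex hv hf
  have hp := h.hp
  have hq := h.hq
  have hβ1 : β = 1 := by
    have : β * (2 * p * q) = 1 * (2 * p * q) := by
      rw [one_mul]
      nth_rewrite 2 [← h2]
      rw [he]
      ring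
    exact mul_right_cancel₀ (by positivity) this
  have hα1 : α = 1 := by
    rw [hβ1, he] at h1
    have : α * p = 1 * p := by linarith
    exact mul_right_cancel₀ hp.ne' this
  rw [hα1, hβ1, one_smul, one_smul, add_right_inj] at hux
  rwa [← hux]

/-- A face at the smaller radius which is not a rhombus has a large angle. -/
theorem inner_le_neg_half [FiniteDimensional ℝ E] (h : Bip V A B p q R) (hqp : q ≤ p)
    {v u u' n : E} (hv : v ∈ B) (hf : IsFlag V v u u' n) (hlt : inner ℝ u u' < q - p) :
    inner ℝ u u' ≤ -(1 / 2) := by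
  obtain ⟨x, hx, α, β, hnx, hα, hβ, he, h1, h2⟩ := h.next_vertex hv hf
  obtain ⟨x', hx', α', β', -, -, -, he', h1', h2'⟩ := h.next_vertex hv hf.symm
  rw [real_inner_comm] at h1' h2'
  have hp := h.hp
  have hq := h.hq
  have hD : p ^ 2 + q ^ 2 + inner ℝ u u' * (p - q) ≠ 0 := fun h0 => by
    rw [h0, mul_zero] at h2
    have : 0 < 2 * p * q := by positivity
    linarith
  obtain rfl : β = β' := mul_right_cancel₀ hD (h2.trans h2'.symm)
  obtain rfl : α = α' := mul_right_cancel₀ hp.ne' (h1.trans h1'.symm)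
  have hw := h.add_memA hv hf.mem
  have hw' := h.add_memA hv hf.mem'
  have hz := h.swap.add_memA hw hx
  have hz' := h.swap.add_memA hw' hx'
  have hnz : inner ℝ n (v + u + x) = inner ℝ n v := by
    rw [inner_add_right, inner_add_right, hnx, hf.inner_eq, add_zero, add_zero]
  obtain ⟨y, hy, hyx, hny⟩ := exists_face_dir h.exposed (e := -x) (h.memB hz) (h.memB hv)
    (by rw [hnz]; exact hf.le h.exposed) hnz.symm (fun t ht => by
      have : α • u + β • u' = (t * (α - 1)) • u + (t * β) • u' := by
        have e1 : x = (α - 1) • u + β • u' := by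
          rw [← add_right_inj u, he]
          module
        rw [add_assoc, sub_add_cancel_left, smul_neg, neg_inj, he] at ht
        rw [ht, e1]
        module
      obtain ⟨e1, e2⟩ := h.comb_inj hv hf.mem hf.mem' hf.ne this
      have : t = 1 := by
        have : t * β = 1 * β := by linarith
        exact mul_right_cancel₀ hβ.ne' this
      rw [this] at e1
      linarith)
  have hya := h.add_memA hz hy
  have hyV := (h.mem_iff _).2 (Or.inl hya)
  obtain ⟨s, r, -, -, hsr⟩ := hf.exists_eq h.exposed hyV (by rw [inner_add_right, hny, hnz, add_zero])
  have hzy : inner ℝ (v + u + x) (v + u + x + y) = R + q - q := by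
    rw [inner_add_right, h.sqB _ hz, h.innerB _ hz y hy]
    ring
  have hzc : v + u + x = v + (α • u + β • u') := by rw [add_assoc, he]
  have hzc' : v + u' + x' = v + (β • u + α • u') := by rw [add_assoc, he', add_comm (β • u)]
  have hne : ∀ z ∈ B, v + (s • u + r • u') ≠ z := fun z hz hc => by
    rw [hsr] at hya
    exact h.notMem _ hya (hc ▸ hz)
  rw [hsr] at hyV hya
  have hαβ : β < α := by
    have : β * p < α * p := by
      rw [h1]
      exact mul_lt_mul_of_pos_left (by linarith) hβ
    exact lt_of_mul_lt_mul_right this hp.le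
  have key := half_le_of_third_vertex (κ := -inner ℝ u u') (a := α) (b := β) (s := s) (r := r)
    hq h.hpq hqp (by linarith [h.neg_one_lt_inner hv hf.mem hf.mem']) (by linarith)
    (by linarith) (by linarith) (by
      have := h.sqA _ hya
      rw [h.inner_add_comb hv hf.mem hf.mem'] at this
      linarith) (by
      have := h.inner_le hv hyV (hne v hv)
      have e := h.inner_add_comb hv hf.mem hf.mem' 0 0 s r
      rw [zero_smul, zero_smul, add_zero, add_zero] at e
      rw [e, h.sqB v hv] at this
      have : q * 1 ≤ q * (s + r) := by linarith
      exact le_of_mul_le_mul_left this hq) (by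
      rintro ⟨rfl, rfl⟩
      rw [one_smul, zero_smul, add_zero, add_assoc (v + u), add_eq_left] at hsr
      exact hyx (eq_neg_of_add_eq_zero_right hsr)) (by
      rintro ⟨rfl, rfl⟩
      rw [hsr, hzc, h.inner_add_comb hv hf.mem hf.mem'] at hzy
      have e1 : α * (q - inner ℝ u u') = β * p := by
        obtain rfl : p = 1 - q := by linarith [h.hpq]
        linarith
      have : β * p < α * (q - inner ℝ u u') :=
        mul_lt_mul hαβ (by linarith) hp hα
      linarith) (by
      have := h.inner_le hz hyV (hne _ hz)
      rw [h.sqB _ hz, hzc, h.inner_add_comb hv hf.mem hf.mem'] at this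
      linarith) (by
      have := h.inner_le hz' hyV (hne _ hz')
      rw [h.sqB _ hz', hzc', h.inner_add_comb hv hf.mem hf.mem'] at this
      linarith)
  linarith

end Bip

end Bipartite

section Strict

variable {E : Type*} [NormedAddCommGroup E] [InnerProductSpace ℝ E]

/-- Vectors in an open half-space with pairwise nonpositive inner products are linearly
independent. -/
theorem eq_zero_of_sum_smul_eq_zero {S : Finset E} {v : E} (hv : ∀ u ∈ S, inner ℝ v u < 0)
    (hS : ∀ u ∈ S, ∀ u' ∈ S, u ≠ u' → inner ℝ u u' ≤ 0) {a : E → ℝ}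
    (h : ∑ u ∈ S, a u • u = 0) : ∀ u ∈ S, a u = 0 := by
  have key : ∀ b : E → ℝ, (∀ u, 0 ≤ b u) → ∑ u ∈ S, b u • u = 0 → ∀ u ∈ S, b u = 0 := by
    intro b hb hsum u hu
    have h1 := congrArg (inner ℝ v) hsum
    rw [inner_sum, inner_zero_right] at h1
    simp only [inner_smul_right] at h1
    have h2 := (Finset.sum_eq_zero_iff_of_nonpos fun u hu =>
      mul_nonpos_of_nonneg_of_nonpos (hb u) (hv u hu).le).1 h1 u hu
    exact (mul_eq_zero.1 h2).resolve_right (hv u hu).ne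
  have hsub : ∑ u ∈ S, (max (a u) 0) • u = ∑ u ∈ S, (max (-a u) 0) • u := by
    rw [← sub_eq_zero, ← Finset.sum_sub_distrib, ← h]
    refine Finset.sum_congr rfl fun u _ => ?_
    rw [← sub_smul]
    congr 1
    rcases le_total (a u) 0 with h | h
    · rw [max_eq_right h, max_eq_left (by linarith)]
      ring
    · rw [max_eq_left h, max_eq_right (by linarith)]
      ring
  have h0 : ∑ u ∈ S, (max (a u) 0) • u = 0 := by
    rw [← inner_self_eq_zero (𝕜 := ℝ)]
    refine le_antisymm ?_ real_inner_self_nonneg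
    nth_rewrite 2 [hsub]
    rw [sum_inner]
    refine Finset.sum_nonpos fun u hu => ?_
    rw [inner_sum]
    refine Finset.sum_nonpos fun u' hu' => ?_
    rw [real_inner_smul_left, real_inner_smul_right]
    by_cases hne : u = u'
    · subst hne
      rcases le_total (a u) 0 with h | h
      · rw [max_eq_right h, zero_mul]
      · rw [max_eq_right (a := -a u) (by linarith), zero_mul, mul_zero]
    · exact mul_nonpos_of_nonneg_of_nonpos (le_max_right _ _)
        (mul_nonpos_of_nonneg_of_nonpos (le_max_right _ _) (hS u hu u' hu' hne))
  intro u hu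
  have h1 := key (fun u => max (a u) 0) (fun u => le_max_right _ _) h0 u hu
  have h2 := key (fun u => max (-a u) 0) (fun u => le_max_right _ _) (hsub ▸ h0) u hu
  have h3 := le_max_left (a u) 0
  have h4 := le_max_left (-a u) 0
  linarith

theorem exists_inner_eq_zero_and_neg [FiniteDimensional ℝ E] {S T : Finset E} (hTS : T ⊆ S) {v : E}
    (hv : ∀ u ∈ S, inner ℝ v u < 0) (hS : ∀ u ∈ S, ∀ u' ∈ S, u ≠ u' → inner ℝ u u' ≤ 0) :
    ∃ n : E, (∀ u ∈ T, inner ℝ n u = 0) ∧ ∀ u ∈ S, u ∉ T → inner ℝ n u < 0 := by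
  classical
  obtain ⟨n, hn, hneg⟩ := exists_orthogonal_inner_neg (S \ T) (Submodule.span ℝ (T : Set E)) (by
    intro a ha hmem s hs
    obtain ⟨f, -, hf⟩ := Submodule.mem_span_finset.1 hmem
    have h0 : ∑ u ∈ S, (if u ∈ T then -f u else a u) • u = 0 := by
      rw [← Finset.sum_sdiff hTS, Finset.sum_congr (s₁ := S \ T) rfl fun u hu => by
        rw [if_neg (Finset.mem_sdiff.1 hu).2], Finset.sum_congr (s₁ := T) rfl fun u hu => by
        rw [if_pos hu, neg_smul], ← hf, Finset.sum_neg_distrib, add_neg_cancel]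
    have := eq_zero_of_sum_smul_eq_zero hv hS h0 s (Finset.mem_sdiff.1 hs).1
    rwa [if_neg (Finset.mem_sdiff.1 hs).2] at this)
  exact ⟨n, fun u hu => hn u (Submodule.subset_span hu),
    fun u hu hT => hneg u (Finset.mem_sdiff.2 ⟨hu, hT⟩)⟩

namespace Bip

variable {V : Finset E} {A B : Set E} {p q R : ℝ}

theorem exists_inner_dirs_neg [FiniteDimensional ℝ E] (h : Bip V A B p q R) (hqp : q ≤ p) {v : E}
    (hv : v ∈ B) {T : Finset E} (hT : T ⊆ dirs V v) :
    ∃ n : E, (∀ u ∈ T, inner ℝ n u = 0) ∧ ∀ u ∈ dirs V v, u ∉ T → inner ℝ n u < 0 :=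
  exists_inner_eq_zero_and_neg hT (fun u hu => by rw [h.innerB v hv u hu]; linarith [h.hq])
    fun u hu u' hu' hne => (h.inner_dirs_le hv hu hu' hne).trans (by linarith)

theorem exists_isFlag [FiniteDimensional ℝ E] (h : Bip V A B p q R) (hqp : q ≤ p) {v u u' : E}
    (hv : v ∈ B) (hu : u ∈ dirs V v) (hu' : u' ∈ dirs V v) (hne : u ≠ u') :
    ∃ n, IsFlag V v u u' n := by
  classical
  obtain ⟨n, hn, hneg⟩ := h.exists_inner_dirs_neg hqp hv (T := {u, u'})
    (Finset.insert_subset hu (Finset.singleton_subset_iff.2 hu'))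
  exact ⟨n, hu, hu', hne, hn u (by simp), hn u' (by simp),
    fun x hx h1 h2 => hneg x hx (by simp [h1, h2])⟩

/-- In an extremal position, a pair of edge vectors at a vertex translates to a pair of edge
vectors spanning a face at a neighbouring vertex. -/
theorem exists_isFlag_neighbour [FiniteDimensional ℝ E] (h : Bip V A B p q R) (hlt : q < p)
    {v u₁ u₂ u₃ : E} (hv : v ∈ B) (h₁ : u₁ ∈ dirs V v) (h₂ : u₂ ∈ dirs V v) (h₃ : u₃ ∈ dirs V v)
    (h12 : u₁ ≠ u₂) (h13 : u₁ ≠ u₃) (h23 : u₂ ≠ u₃) (e12 : inner ℝ u₁ u₂ = q - p)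
    (e13 : inner ℝ u₁ u₃ = q - p) (hsum : 0 < 1 - 2 * (p - q) + inner ℝ u₂ u₃) :
    ∃ n, IsFlag V (v + u₁) u₂ u₃ n := by
  classical
  obtain ⟨m₂, hm₂⟩ := h.exists_isFlag hlt.le hv h₁ h₂ h12
  obtain ⟨m₃, hm₃⟩ := h.exists_isFlag hlt.le hv h₁ h₃ h13
  have h₂' := h.mem_dirs_of_inner_eq hv hm₂ e12
  have h₃' := h.mem_dirs_of_inner_eq hv hm₃ e13
  have h₁' := neg_mem_dirs h₁
  have hw := h.add_memA hv h₁
  obtain ⟨n, hn, hneg⟩ := h.exists_inner_dirs_neg hlt.le hv (T := {u₁, u₂, u₃}) (by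
    simp [Finset.insert_subset_iff, h₁, h₂, h₃])
  have hn₁ := hn u₁ (by simp)
  have hn₂ := hn u₂ (by simp)
  have hn₃ := hn u₃ (by simp)
  have hmax : ∀ y ∈ V, inner ℝ n y ≤ inner ℝ n v := inner_le_of_dirs h.exposed (h.memB hv)
    fun u hu => by
      by_cases hT : u ∈ ({u₁, u₂, u₃} : Finset E)
      · exact (hn u hT).le
      · exact (hneg u hu hT).le
  have hnw : inner ℝ n (v + u₁) = inner ℝ n v := by rw [inner_add_right, hn₁, add_zero]
  have hface : ∀ x ∈ dirs V (v + u₁), inner ℝ n x = 0 → x = -u₁ ∨ x = u₂ ∨ x = u₃ := by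
    intro x hx hnx
    by_contra! hne
    obtain ⟨a, -, hs, h0⟩ := exists_face_combination h.exposed (h.memB hv) (mem_dirs.1 hx).2.1 hmax
      (by rw [inner_add_right, hnw, hnx, add_zero])
    rw [← Finset.sum_subset (s₁ := {u₁, u₂, u₃}) (by
      simp [Finset.insert_subset_iff, h₁, h₂, h₃]) (fun u hu hT => by
        rw [h0 u hu (hneg u hu hT).ne, zero_smul]), Finset.sum_insert (by simp [h12, h13]),
        Finset.sum_pair h23, add_assoc, add_sub_cancel_left] at hs
    have hxe : x = (a u₁ - 1) • u₁ + a u₂ • u₂ + a u₃ • u₃ := by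
      rw [← add_right_inj u₁, hs]
      module
    have s1 := h.inner_self v u₁ h₁
    have s2 := h.inner_self v u₂ h₂
    have s3 := h.inner_self v u₃ h₃
    have iw := h.innerA _ hw x hx
    have iw1 := h.innerA _ hw _ h₁'
    have iw2 := h.innerA _ hw _ h₂'
    have iw3 := h.innerA _ hw _ h₃'
    rw [inner_neg_right] at iw1
    have k1 := h.swap.inner_dirs_le hw h₁' hx (Ne.symm hne.1)
    have k2 := h.swap.inner_dirs_le hw h₂' hx (Ne.symm hne.2.1)
    have k3 := h.swap.inner_dirs_le hw h₃' hx (Ne.symm hne.2.2)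
    rw [hxe] at iw k1 k2 k3
    simp only [inner_neg_left, inner_add_right, real_inner_smul_right, iw2, iw3, s1, s2, s3,
      e12, e13, real_inner_comm u₁ u₂, real_inner_comm u₁ u₃, real_inner_comm u₂ u₃]
      at iw k1 k2 k3
    have hp := h.hp
    have iw1' : inner ℝ (v + u₁) u₁ = p := by linarith
    have hc : a u₂ + a u₃ = 1 + (a u₁ - 1) := by
      rw [iw1'] at iw
      have : p * (a u₂ + a u₃) = p * (1 + (a u₁ - 1)) := by linarith
      exact mul_left_cancel₀ hp.ne' this
    have hα : 0 ≤ a u₁ - 1 := by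
      have e : (a u₁ - 1) * (q - p + 1) ≥ 0 := by
        have : (a u₁ - 1) * 1 - (p - q) * (a u₂ + a u₃) + (p - q) ≥ 0 := by linarith
        rw [hc] at this
        nlinarith
      exact nonneg_of_mul_nonneg_left e (by linarith [h.hq, h.hpq])
    have e : (1 + (a u₁ - 1)) * (1 - 2 * (p - q) + inner ℝ u₂ u₃) ≤ 0 := by
      have e : (a u₂ + a u₃) * (1 + inner ℝ u₂ u₃) - 2 * (a u₁ - 1) * (p - q) ≤ 2 * (p - q) := by
        linarith
      rw [hc] at e
      linarith
    have := mul_pos (by linarith : 0 < 1 + (a u₁ - 1)) hsum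
    linarith
  obtain ⟨m, hm, hm'⟩ := exists_orthogonal_inner_neg (dirs V (v + u₁) \ {u₂, u₃})
    (Submodule.span ℝ {u₂, u₃}) (by
    intro a ha hmem
    have hnU : inner ℝ n (∑ s ∈ dirs V (v + u₁) \ {u₂, u₃}, a s • s) = 0 := by
      obtain ⟨b, c, hbc⟩ := Submodule.mem_span_pair.1 hmem
      rw [← hbc, inner_add_right, inner_smul_right, inner_smul_right, hn₂, hn₃]
      simp
    rw [inner_sum] at hnU
    simp only [inner_smul_right] at hnU
    have hle : ∀ s ∈ dirs V (v + u₁) \ {u₂, u₃}, a s * inner ℝ n s ≤ 0 := fun s hs => by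
      have := hmax _ (mem_dirs.1 (Finset.mem_sdiff.1 hs).1).2.1
      rw [inner_add_right, hnw] at this
      exact mul_nonpos_of_nonneg_of_nonpos (ha s hs) (by linarith)
    have hz : ∀ s ∈ dirs V (v + u₁) \ {u₂, u₃}, s ≠ -u₁ → a s = 0 := fun s hs hs1 => by
      refine (mul_eq_zero.1 ((Finset.sum_eq_zero_iff_of_nonpos hle).1 hnU s hs)).resolve_right
        fun h0 => ?_
      obtain ⟨hs, hs'⟩ := Finset.mem_sdiff.1 hs
      rcases hface s hs h0 with h | h | h <;> simp_all
    intro s hs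
    by_cases hs1 : s = -u₁
    · by_contra hne
      rw [Finset.sum_eq_single_of_mem s hs fun t ht hts => by
        rw [hz t ht (hs1 ▸ hts), zero_smul]] at hmem
      have hu : u₁ ∈ Submodule.span ℝ {u₂, u₃} := by
        rw [Submodule.smul_mem_iff _ hne, hs1] at hmem
        simpa using hmem
      obtain ⟨b, c, hbc⟩ := Submodule.mem_span_pair.1 hu
      have e1 := congrArg (inner ℝ v) hbc
      have e2 := congrArg (inner ℝ u₁) hbc
      rw [inner_add_right, inner_smul_right, inner_smul_right, h.innerB v hv _ h₁,
        h.innerB v hv _ h₂, h.innerB v hv _ h₃] at e1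
      rw [inner_add_right, inner_smul_right, inner_smul_right, e12, e13,
        h.inner_self v _ h₁] at e2
      have e3 : b + c = 1 := by
        have : q * (b + c) = q * 1 := by linarith
        exact mul_left_cancel₀ h.hq.ne' this
      have : (b + c) * (q - p) = 1 := by linarith
      rw [e3] at this
      linarith
    · exact hz s hs hs1)
  exact ⟨m, h₂', h₃', h23, hm _ (Submodule.subset_span (by simp)),
    hm _ (Submodule.subset_span (by simp)), fun x hx hx2 hx3 => hm' x (by simp [hx, hx2, hx3])⟩

/-- There is no strictly bipartite configuration with at least four edges at every vertex of
smaller radius, if the edge vectors there have positive total inner products. -/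
theorem false_of_lt [FiniteDimensional ℝ E] (h : Bip V A B p q R) (hlt : q < p) (hB : B.Nonempty)
    (hrow : ∀ v ∈ B, ∀ u ∈ dirs V v, 0 < ∑ u' ∈ dirs V v, inner ℝ u u')
    (hcard : ∀ v ∈ B, 4 ≤ (dirs V v).card) : False := by
  classical
  have hp := h.hp
  have hq := h.hq
  have hpq := h.hpq
  have hle : ∀ v ∈ B, ∀ u ∈ dirs V v, ∀ u' ∈ dirs V v, u ≠ u' → inner ℝ u u' ≤ q - p :=
    fun v hv u hu u' hu' hne => h.inner_dirs_le hv hu hu' hne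
  have hhalf : ∀ v ∈ B, ∀ u ∈ dirs V v, ∀ u' ∈ dirs V v, u ≠ u' → inner ℝ u u' < q - p →
      inner ℝ u u' ≤ -(1 / 2) := fun v hv u hu u' hu' hne hlt' => by
    obtain ⟨n, hn⟩ := h.exists_isFlag hlt.le hv hu hu' hne
    exact h.inner_le_neg_half hlt.le hv hn hlt'
  have hrow4 : ∀ v ∈ B, ∀ u ∈ dirs V v, ∀ x ∈ dirs V v, ∀ y ∈ dirs V v, ∀ z ∈ dirs V v,
      u ≠ x → u ≠ y → u ≠ z → x ≠ y → x ≠ z → y ≠ z →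
      0 < 1 + inner ℝ u x + inner ℝ u y + inner ℝ u z := by
    intro v hv u hu x hx y hy z hz hux huy huz hxy hxz hyz
    refine (hrow v hv u hu).trans_le ?_
    have hsub : ({u, x, y, z} : Finset E) ⊆ dirs V v := by
      simp [Finset.insert_subset_iff, hu, hx, hy, hz]
    rw [← Finset.sum_sdiff hsub, Finset.sum_insert (by simp [hux, huy, huz]),
      Finset.sum_insert (by simp [hxy, hxz]), Finset.sum_pair hyz, h.inner_self v u hu]
    have : ∑ u' ∈ dirs V v \ {u, x, y, z}, inner ℝ u u' ≤ 0 :=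
      Finset.sum_nonpos fun u' hu' => by
        obtain ⟨h1, h2⟩ := Finset.mem_sdiff.1 hu'
        have := hle v hv u hu u' h1 fun hc => h2 (by simp [hc])
        linarith
    linarith
  obtain ⟨b, hb⟩ := hB
  obtain ⟨x₀, hx₀, y₀, hy₀, hxy₀⟩ := Finset.one_lt_card.1 (by have := hcard b hb; omega : 1 < (dirs V b).card)
  obtain ⟨⟨v, u₂, u₃⟩, hmem, hmin⟩ := Finset.exists_min_image
    ((V.filter (· ∈ B)).sigma fun v => (dirs V v).offDiag)
    (fun x => inner ℝ x.2.1 x.2.2) ⟨⟨b, x₀, y₀⟩, by simp [h.memB hb, hb, hx₀, hy₀, hxy₀]⟩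
  simp only [Finset.mem_sigma, Finset.mem_filter, Finset.mem_offDiag] at hmem hmin
  obtain ⟨⟨-, hv⟩, h₂, h₃, h23⟩ := hmem
  replace hmin : ∀ w ∈ B, ∀ u ∈ dirs V w, ∀ u' ∈ dirs V w, u ≠ u' →
      inner ℝ u₂ u₃ ≤ inner ℝ u u' := fun w hw u hu u' hu' hne =>
    hmin ⟨w, u, u'⟩ ⟨⟨h.memB hw, hw⟩, hu, hu', hne⟩
  obtain ⟨u₁, h₁, hn₁⟩ := Finset.exists_mem_notMem_of_card_lt_card
    (s := {u₂, u₃}) (t := dirs V v)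
    (lt_of_le_of_lt Finset.card_le_two (by have := hcard v hv; omega))
  obtain ⟨u₄, h₄, hn₄⟩ := Finset.exists_mem_notMem_of_card_lt_card
    (s := {u₁, u₂, u₃}) (t := dirs V v)
    (lt_of_le_of_lt Finset.card_le_three (by have := hcard v hv; omega))
  simp only [Finset.mem_insert, Finset.mem_singleton, not_or] at hn₁ hn₄
  have r2 := hrow4 v hv u₂ h₂ u₁ h₁ u₃ h₃ u₄ h₄ (Ne.symm hn₁.1) h23 (Ne.symm hn₄.2.1) hn₁.2
    (Ne.symm hn₄.1) (Ne.symm hn₄.2.2)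
  have r3 := hrow4 v hv u₃ h₃ u₁ h₁ u₂ h₂ u₄ h₄ (Ne.symm hn₁.2) h23.symm (Ne.symm hn₄.2.2) hn₁.1
    (Ne.symm hn₄.1) (Ne.symm hn₄.2.1)
  have l21 := hle v hv u₂ h₂ u₁ h₁ (Ne.symm hn₁.1)
  have l31 := hle v hv u₃ h₃ u₁ h₁ (Ne.symm hn₁.2)
  have l23 := hle v hv u₂ h₂ u₃ h₃ h23
  have l24 := hle v hv u₂ h₂ u₄ h₄ (Ne.symm hn₄.2.1)
  have l34 := hle v hv u₃ h₃ u₄ h₄ (Ne.symm hn₄.2.2)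
  have m21 := hmin v hv u₂ h₂ u₁ h₁ (Ne.symm hn₁.1)
  have m31 := hmin v hv u₃ h₃ u₁ h₁ (Ne.symm hn₁.2)
  rw [real_inner_comm u₂ u₃] at r3
  have e21 : inner ℝ u₂ u₁ = q - p := by
    by_contra hne
    have := hhalf v hv u₂ h₂ u₁ h₁ (Ne.symm hn₁.1) (lt_of_le_of_ne l21 hne)
    linarith
  have e31 : inner ℝ u₃ u₁ = q - p := by
    by_contra hne
    have := hhalf v hv u₃ h₃ u₁ h₁ (Ne.symm hn₁.2) (lt_of_le_of_ne l31 hne)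
    linarith
  have hsum : 0 < 1 - 2 * (p - q) + inner ℝ u₂ u₃ := by linarith
  obtain ⟨n, hn⟩ := h.exists_isFlag_neighbour hlt hv h₁ h₂ h₃ hn₁.1 hn₁.2 h23
    (by rw [real_inner_comm, e21]) (by rw [real_inner_comm, e31]) hsum
  have hw := h.add_memA hv h₁
  obtain ⟨x, hx, α, β, -, -, hβ, he, hα, hβD⟩ := h.swap.next_vertex hw hn
  have hz := h.swap.add_memA hw hn.mem
  have hxe : x = (α - 1) • u₂ + β • u₃ := by
    rw [← add_right_inj u₂, he]
    module
  have hxne : -u₂ ≠ x := fun hc => by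
    rw [← hc, add_neg_cancel] at he
    have := h.comb_inj hv h₂ h₃ h23 (s := 0) (r := 0) (a := α) (b := β) (by rw [← he]; simp)
    exact hβ.ne this.2
  have m := hmin _ hz _ (neg_mem_dirs hn.mem) x hx hxne
  rw [hxe, inner_neg_left, inner_add_right, real_inner_smul_right, real_inner_smul_right,
    h.inner_self v u₂ h₂] at m
  have hκ : -1 < inner ℝ u₂ u₃ := h.neg_one_lt_inner hv h₂ h₃
  set g : ℝ := inner ℝ u₂ u₃
  have e1 : β * p * (1 - g) ≤ q * (1 - g) := by
    obtain rfl : p = 1 - q := by linarith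
    have := mul_le_mul_of_nonneg_left m hq.le
    linarith
  have e2 : β * p ≤ q := le_of_mul_le_mul_right e1 (by linarith)
  have hD : 0 < q ^ 2 + p ^ 2 + g * (q - p) := by
    have : 0 < β * (q ^ 2 + p ^ 2 + g * (q - p)) := by rw [hβD]; positivity
    exact pos_of_mul_pos_right this hβ.le
  have e3 := mul_le_mul_of_nonneg_right e2 hD.le
  have e4 : q * (2 * p ^ 2) ≤ q * (q ^ 2 + p ^ 2 + g * (q - p)) := by
    have : β * p * (q ^ 2 + p ^ 2 + g * (q - p)) = p * (2 * q * p) := by rw [← hβD]; ring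
    rw [this] at e3
    linarith
  have e5 := le_of_mul_le_mul_left e4 hq
  have e6 : (p - q) * ((p + q) + g) ≤ 0 := by linarith
  rw [hpq] at e6
  have := mul_pos (sub_pos.2 hlt) (by linarith : 0 < 1 + g)
  linarith

end Bip

end Strict

section Reflection

variable {E : Type*} [NormedAddCommGroup E] [InnerProductSpace ℝ E]

theorem reflection_orthogonal_singleton {u : E} (hu : inner ℝ u u = 1) (x : E) :
    (ℝ ∙ u)ᗮ.reflection x = x - (2 * inner ℝ u x) • u := by
  have hu' : ‖u‖ = 1 := by
    rw [real_inner_self_eq_norm_sq] at hu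
    nlinarith [norm_nonneg u]
  rw [Submodule.reflection_orthogonal_apply, Submodule.reflection_singleton_apply, hu']
  simp only [RCLike.ofReal_real_eq_id, id_eq, one_pow, div_one, neg_sub, two_smul,
    two_mul, add_smul]

theorem reflection_map (T : E ≃ₗᵢ[ℝ] E) {u : E} (hu : inner ℝ u u = 1) (x : E) :
    (ℝ ∙ T u)ᗮ.reflection (T x) = T ((ℝ ∙ u)ᗮ.reflection x) := by
  rw [reflection_orthogonal_singleton hu, reflection_orthogonal_singleton
    (by rw [T.inner_map_map, hu]), T.inner_map_map, map_sub, map_smul]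

namespace Bip

variable {V : Finset E} {A B : Set E} {p R : ℝ}

theorem reflection_mem_dirs_of_memB [FiniteDimensional ℝ E] (h : Bip V A B p p R) {v u y : E}
    (hv : v ∈ B) (hu : u ∈ dirs V v) (hy : y ∈ dirs V v) :
    (ℝ ∙ u)ᗮ.reflection y ∈ dirs V (v + u) := by
  have hp := h.hp
  have hpp := h.hpq
  rw [reflection_orthogonal_singleton (h.inner_self v u hu)]
  by_cases hne : u = y
  · rw [← hne, h.inner_self v u hu, show u - (2 * 1 : ℝ) • u = -u by module]
    exact neg_mem_dirs hu
  obtain ⟨n, hn⟩ := h.exists_isFlag le_rfl hv hu hy hne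
  obtain ⟨x, hx, α, β, -, -, -, he, hα, hβ⟩ := h.next_vertex hv hn
  obtain rfl : p = 1 / 2 := by linarith
  have hβ1 : β = 1 := by linarith
  have hα1 : α = 1 - 2 * inner ℝ u y := by
    rw [hβ1] at hα
    linarith
  rw [hα1, hβ1] at he
  convert hx using 1
  rw [← add_right_inj u, he]
  module

theorem reflection_mem_dirs [FiniteDimensional ℝ E] (h : Bip V A B p p R) {v u y : E}
    (hu : u ∈ dirs V v) (hy : y ∈ dirs V v) : (ℝ ∙ u)ᗮ.reflection y ∈ dirs V (v + u) :=
  ((h.mem_iff v).1 (mem_dirs.1 hu).1).elim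
    (fun hv => h.swap.reflection_mem_dirs_of_memB hv hu hy)
    (fun hv => h.reflection_mem_dirs_of_memB hv hu hy)

theorem reflection_mem_dirs_iff [FiniteDimensional ℝ E] (h : Bip V A B p p R) {v u y : E}
    (hu : u ∈ dirs V v) : (ℝ ∙ u)ᗮ.reflection y ∈ dirs V v ↔ y ∈ dirs V (v + u) := by
  constructor
  · intro hy
    have := h.reflection_mem_dirs hu hy
    rwa [Submodule.reflection_reflection] at this
  · intro hy
    have := h.reflection_mem_dirs (neg_mem_dirs hu) hy
    have hu' := h.inner_self v u hu
    rw [add_neg_cancel_right, reflection_orthogonal_singleton (by simpa using hu'),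
      inner_neg_left, mul_neg, neg_smul_neg] at this
    rwa [reflection_orthogonal_singleton hu']

/-- If both classes lie on the same sphere, the reflection exchanging the ends of an edge is a
symmetry. -/
theorem reflection_mem [FiniteDimensional ℝ E] (h : Bip V A B p p R) {v u : E}
    (hv : v ∈ B) (hu : u ∈ dirs V v) :
    (ℝ ∙ u)ᗮ.reflection v = v + u ∧ ∀ x ∈ V, (ℝ ∙ u)ᗮ.reflection x ∈ V := by
  have hsv : (ℝ ∙ u)ᗮ.reflection v = v + u := by
    rw [reflection_orthogonal_singleton (h.inner_self v u hu), real_inner_comm, h.innerB v hv u hu,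
      sub_eq_add_neg, ← neg_smul, show -(2 * -p) = 1 by linarith [h.hpq], one_smul]
  refine ⟨hsv, ?_⟩
  set s := (ℝ ∙ u)ᗮ.reflection
  have key := subset_of_adj_closed h.exposed (h.memB hv)
    (G := fun x => s x ∈ V ∧ ∀ y, s y ∈ dirs V (s x) ↔ y ∈ dirs V x)
    ⟨by rw [hsv]; exact (mem_dirs.1 hu).2.1, fun y => by
      rw [hsv, ← h.reflection_mem_dirs_iff hu, Submodule.reflection_reflection]⟩ (by
    rintro x y ⟨hsx, hx⟩ hxy
    have hz : y - x ∈ dirs V x := by rwa [mem_dirs, add_sub_cancel]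
    have hsz := (hx _).2 hz
    have hsy : s y = s x + s (y - x) := by rw [map_sub, add_sub_cancel]
    refine ⟨by rw [hsy]; exact (mem_dirs.1 hsz).2.1, fun t => ?_⟩
    rw [hsy, ← h.reflection_mem_dirs_iff hsz, reflection_map s (h.inner_self x _ hz), hx,
      h.reflection_mem_dirs_iff hz, add_sub_cancel])
  exact fun x hx => (key x hx).1

end Bip

end Reflection

section Symmetry

variable {E : Type*} [NormedAddCommGroup E] [InnerProductSpace ℝ E]

theorem Adj.image [DecidableEq E] {V : Finset E} {v w : E} (h : Adj V v w) {f g : E → E} {r : ℝ}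
    (hr : 0 < r) (hf : ∀ n x y, inner ℝ (g n) (f x - f y) = r * inner ℝ n (x - y)) :
    Adj (V.image f) (f v) (f w) := by
  obtain ⟨hv, hw, hne, n, hn, hlt⟩ := h
  refine ⟨Finset.mem_image_of_mem f hv, Finset.mem_image_of_mem f hw, fun he => hne ?_, g n, ?_, ?_⟩
  · have := hf (v - w) v w
    rw [he, sub_self, inner_zero_right] at this
    exact sub_eq_zero.1 (inner_self_eq_zero.1 ((mul_eq_zero.1 this.symm).resolve_left hr.ne'))
  · have := hf n v w
    rw [inner_sub_right, inner_sub_right, hn, sub_self, mul_zero] at this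
    linarith
  · intro x hx hxv hxw
    obtain ⟨y, hy, rfl⟩ := Finset.mem_image.1 hx
    have h1 := hlt y hy (fun h => hxv (h ▸ rfl)) (fun h => hxw (h ▸ rfl))
    have h2 := hf n v y
    rw [inner_sub_right, inner_sub_right] at h2
    have := mul_pos hr (sub_pos.2 h1)
    linarith

theorem AllExposed.image [DecidableEq E] {V : Finset E} (h : AllExposed V) {f g : E → E} {r : ℝ}
    (hr : 0 < r) (hf : ∀ n x y, inner ℝ (g n) (f x - f y) = r * inner ℝ n (x - y)) :
    AllExposed (V.image f) := by
  intro z hz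
  obtain ⟨v, hv, rfl⟩ := Finset.mem_image.1 hz
  obtain ⟨n, hn⟩ := h v hv
  refine ⟨g n, fun x hx hxv => ?_⟩
  obtain ⟨y, hy, rfl⟩ := Finset.mem_image.1 hx
  have h1 := hn y hy (fun h => hxv (h ▸ rfl))
  have h2 := hf n v y
  rw [inner_sub_right, inner_sub_right] at h2
  have := mul_pos hr (sub_pos.2 h1)
  linarith

/-- `T` is a symmetry of `V` fixing `c`. -/
def IsSym (V : Finset E) (c : E) (T : E ≃ₗᵢ[ℝ] E) : Prop :=
  T '' (V : Set E) = V ∧ T c = c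

namespace IsSym

variable {V : Finset E} {c : E} {T S : E ≃ₗᵢ[ℝ] E}

theorem refl : IsSym V c (LinearIsometryEquiv.refl ℝ E) := by
  simp [IsSym]

theorem symm (h : IsSym V c T) : IsSym V c T.symm := by
  constructor
  · nth_rewrite 1 [← h.1]
    rw [Set.image_image]
    simp
  · rw [LinearIsometryEquiv.symm_apply_eq, h.2]

theorem trans (h : IsSym V c T) (h' : IsSym V c S) : IsSym V c (T.trans S) := by
  constructor
  · rw [LinearIsometryEquiv.coe_trans, Set.image_comp, h.1, h'.1]
  · rw [LinearIsometryEquiv.trans_apply, h.2, h'.2]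

theorem mem (h : IsSym V c T) {x : E} (hx : x ∈ V) : T x ∈ V := by
  have : T x ∈ T '' (V : Set E) := ⟨x, hx, rfl⟩
  rwa [h.1] at this

theorem image_eq [DecidableEq E] (h : IsSym V c T) : V.image T = V := by
  rw [← Finset.coe_inj, Finset.coe_image, h.1]

theorem of_mem (h : ∀ x ∈ V, T x ∈ V) (hc : T c = c) : IsSym V c T := by
  classical
  refine ⟨?_, hc⟩
  have h1 : V.image T ⊆ V := Finset.image_subset_iff.2 h
  have h2 := Finset.eq_of_subset_of_card_le h1 (Finset.card_image_of_injective V T.injective).ge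
  rw [← Finset.coe_image, h2]

theorem adj (h : IsSym V c T) {v w : E} (hvw : Adj V v w) : Adj V (T v) (T w) := by
  classical
  have := hvw.image (f := T) (g := T) one_pos fun n x y => by
    rw [← map_sub, T.inner_map_map, one_mul]
  rwa [h.image_eq] at this

theorem mem_dirs (h : IsSym V c T) {v u : E} (hu : u ∈ dirs V v) : T u ∈ dirs V (T v) := by
  rw [_root_.mem_dirs, ← map_add]
  exact h.adj (_root_.mem_dirs.1 hu)

theorem map_sum_dirs (h : IsSym V c T) {v : E} (hv : T v = v) :
    T (∑ u ∈ dirs V v, u) = ∑ u ∈ dirs V v, u := by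
  rw [map_sum]
  refine Finset.sum_nbij T (fun u hu => ?_) T.injective.injOn (fun u hu => ?_) fun _ _ => rfl
  · have := h.mem_dirs hu
    rwa [hv] at this
  · have := h.symm.mem_dirs hu
    rw [show T.symm v = v by rw [LinearIsometryEquiv.symm_apply_eq, hv]] at this
    exact ⟨_, this, by simp⟩

end IsSym

namespace Bip

variable {V : Finset E} {A B : Set E} {p q R : ℝ} {c : E}

theorem sum_inner_pos (h : Bip V A B p q R)
    (hfl : ∀ v ∈ B, ∀ v' ∈ B, ∀ u ∈ dirs V v, ∀ u' ∈ dirs V v',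
      ∃ T, IsSym V c T ∧ T v = v' ∧ T u = u') {v u : E} (hv : v ∈ B) (hu : u ∈ dirs V v) :
    0 < ∑ u' ∈ dirs V v, inner ℝ u u' := by
  have hconst : ∀ w ∈ dirs V v,
      inner ℝ w (∑ u' ∈ dirs V v, u') = inner ℝ u (∑ u' ∈ dirs V v, u') := by
    intro w hw
    obtain ⟨T, hT, hTv, rfl⟩ := hfl v hv v hv u hu w hw
    nth_rewrite 1 [← hT.map_sum_dirs hTv]
    rw [T.inner_map_map]
  rw [← inner_sum]
  by_contra! hle
  have h0 : ∑ u' ∈ dirs V v, u' = 0 := by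
    rw [← inner_self_eq_zero (𝕜 := ℝ)]
    refine le_antisymm ?_ real_inner_self_nonneg
    nth_rewrite 1 [sum_inner]
    exact Finset.sum_nonpos fun w hw => (hconst w hw).trans_le hle
  have h1 := congrArg (inner ℝ v) h0
  rw [inner_sum, inner_zero_right] at h1
  have := Finset.sum_neg (s := dirs V v) (f := fun u => inner ℝ v u)
    (fun w hw => by rw [h.innerB v hv w hw]; linarith [h.hq]) ⟨u, hu⟩
  linarith

/-- Some symmetry exchanges the two classes, given enough symmetries preserving them. -/
theorem exists_isSym [FiniteDimensional ℝ E] (h : Bip V A B p q R) (hqp : q ≤ p) (hB : B.Nonempty)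
    (hcard : ∀ v ∈ B, 4 ≤ (dirs V v).card)
    (hfl : ∀ v ∈ B, ∀ v' ∈ B, ∀ u ∈ dirs V v, ∀ u' ∈ dirs V v',
      ∃ T, IsSym V c T ∧ T v = v' ∧ T u = u') : ∃ b ∈ B, ∃ T, IsSym V c T ∧ T b ∈ A := by
  rcases hqp.lt_or_eq with hlt | rfl
  · exact (h.false_of_lt hlt hB (fun v hv u hu => h.sum_inner_pos hfl hv hu) hcard).elim
  obtain ⟨v, hv⟩ := hB
  obtain ⟨u, hu, u', hu', hne⟩ := Finset.one_lt_card.1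
    (by have := hcard v hv; omega : 1 < (dirs V v).card)
  obtain ⟨hsv, hs⟩ := h.reflection_mem hv hu
  refine ⟨v, hv, _, IsSym.of_mem hs ?_, by rw [hsv]; exact h.add_memA hv hu⟩
  have hτ : ∀ w ∈ B, ∀ x ∈ dirs V w, inner ℝ c x = inner ℝ c u := fun w hw x hx => by
    obtain ⟨T, hT, -, rfl⟩ := hfl v hv w hw u hu x hx
    nth_rewrite 1 [← hT.2]
    rw [T.inner_map_map]
  have hr := h.reflection_mem_dirs hu hu'
  have h1 := hτ _ (h.swap.add_memA (h.add_memA hv hu) hr) _ (neg_mem_dirs hr)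
  have h2 := hτ v hv u' hu'
  rw [reflection_orthogonal_singleton (h.inner_self v u hu), inner_neg_right, inner_sub_right,
    inner_smul_right, h2] at h1
  have h3 : inner ℝ c u * (1 - inner ℝ u u') = 0 := by linarith
  have h4 : inner ℝ c u = 0 := (mul_eq_zero.1 h3).resolve_right
    (by linarith [h.inner_lt_one hu hu' hne])
  rw [reflection_orthogonal_singleton (h.inner_self v u hu), real_inner_comm, h4]
  simp

end Bip

/-- Edge-transitive point configurations centred at the origin are vertex-transitive. -/
theorem exists_isSym_of_sum_eq_zero [FiniteDimensional ℝ E] (hd : 4 ≤ Module.finrank ℝ E)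
    {V : Finset E} {c : E} (hV : AllExposed V)
    (hspan : ∀ U : Submodule ℝ E, (∀ x ∈ V, ∀ y ∈ V, x - y ∈ U) → U = ⊤)
    (hsum : ∑ x ∈ V, x = 0) (hlen : ∀ v, ∀ u ∈ dirs V v, inner ℝ u u = 1)
    (hedge : ∀ v w v' w', Adj V v w → Adj V v' w' →
      ∃ T, IsSym V c T ∧ ((T v = v' ∧ T w = w') ∨ (T v = w' ∧ T w = v'))) :
    ∀ x ∈ V, ∀ y ∈ V, ∃ T, IsSym V c T ∧ T x = y := by
  have hcard : ∀ v ∈ V, 4 ≤ (dirs V v).card := by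
    intro v hv
    have htop : Submodule.span ℝ (dirs V v : Set E) = ⊤ := by
      have hmem : ∀ x ∈ V, x - v ∈ Submodule.span ℝ (dirs V v : Set E) := fun x hx => by
        obtain ⟨a, -, he⟩ := inCone_dirs hV hv hx
        rw [he]
        exact Submodule.sum_mem _ fun u hu => Submodule.smul_mem _ _ (Submodule.subset_span hu)
      refine hspan _ fun x hx y hy => ?_
      rw [← sub_sub_sub_cancel_right x y v]
      exact Submodule.sub_mem _ (hmem x hx) (hmem y hy)
    have := finrank_span_finset_le_card (R := ℝ) (dirs V v)
    rw [Set.finrank, htop, finrank_top] at this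
    omega
  have hdir : ∀ v ∈ V, ∃ u, u ∈ dirs V v := fun v hv =>
    Finset.card_pos.1 (by have := hcard v hv; omega)
  intro x hx y hy
  obtain ⟨u₀, hu₀⟩ := hdir x hx
  set w := x + u₀ with hw
  have hxw : Adj V x w := mem_dirs.1 hu₀
  set A : Set E := {z | z ∈ V ∧ ∃ T, IsSym V c T ∧ T x = z} with hA
  set B : Set E := {z | z ∈ V ∧ ∃ T, IsSym V c T ∧ T w = z} with hB
  have hAB : ∀ z ∈ V, z ∈ A ∨ z ∈ B := by
    intro z hz
    obtain ⟨u, hu⟩ := hdir z hz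
    obtain ⟨T, hT, h | h⟩ := hedge x w z _ hxw (mem_dirs.1 hu)
    · exact Or.inl ⟨hz, T, hT, h.1⟩
    · exact Or.inr ⟨hz, T, hT, h.2⟩
  have hswap : (∃ z ∈ A, z ∈ B) → ∃ T, IsSym V c T ∧ T x = y := by
    rintro ⟨z, ⟨-, T, hT, hTx⟩, -, S, hS, hSw⟩
    rcases hAB y hy with ⟨-, h⟩ | ⟨-, Q, hQ, hQw⟩
    · exact h
    · refine ⟨(T.trans S.symm).trans Q, (hT.trans hS.symm).trans hQ, ?_⟩
      simp [hTx, ← hSw, hQw]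
  by_cases hdis : ∃ z ∈ A, z ∈ B
  · exact hswap hdis
  have hstabA : ∀ z ∈ A, ∀ T, IsSym V c T → T z ∈ A := by
    rintro z ⟨hz, S, hS, rfl⟩ T hT
    exact ⟨hT.mem hz, S.trans T, hS.trans hT, rfl⟩
  have hstabB : ∀ z ∈ B, ∀ T, IsSym V c T → T z ∈ B := by
    rintro z ⟨hz, S, hS, rfl⟩ T hT
    exact ⟨hT.mem hz, S.trans T, hS.trans hT, rfl⟩
  have hxA : x ∈ A := ⟨hx, _, IsSym.refl, rfl⟩
  have hwB : w ∈ B := ⟨hxw.2.1, _, IsSym.refl, rfl⟩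
  have hadjA : ∀ v v', Adj V v v' → v ∈ A →
      ∃ T, IsSym V c T ∧ T x = v ∧ T w = v' := by
    intro v v' hvv' hv
    obtain ⟨T, hT, h | h⟩ := hedge x w v v' hxw hvv'
    · exact ⟨T, hT, h⟩
    · exact (hdis ⟨v, hv, h.2 ▸ hstabB w hwB T hT⟩).elim
  have hadjB : ∀ v v', Adj V v v' → v ∈ B →
      ∃ T, IsSym V c T ∧ T w = v ∧ T x = v' := by
    intro v v' hvv' hv
    obtain ⟨T, hT, h | h⟩ := hedge x w v v' hxw hvv'
    · exact (hdis ⟨v, h.1 ▸ hstabA x hxA T hT, hv⟩).elim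
    · exact ⟨T, hT, h.2, h.1⟩
  have hu₀1 := hlen x u₀ hu₀
  have hnonneg : ∀ v ∈ V, ∀ r : ℝ, (∀ u ∈ dirs V v, inner ℝ v u = -r) → 0 < r := by
    intro v hv r hr
    have hv0 : v ≠ 0 := by
      rintro rfl
      obtain ⟨n, hn⟩ := hV 0 hv
      obtain ⟨u, hu⟩ := hdir 0 hv
      have hadj := mem_dirs.1 hu
      have : ∑ z ∈ V, inner ℝ n z < ∑ z ∈ V, (0 : ℝ) := by
        refine Finset.sum_lt_sum (fun z hz => ?_) ⟨_, hadj.2.1, ?_⟩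
        · by_cases h : z = 0
          · simp [h]
          · have := hn z hz h
            rw [inner_zero_right] at this
            exact this.le
        · have := hn _ hadj.2.1 hadj.2.2.1.symm
          rwa [inner_zero_right] at this
      rw [← inner_sum, hsum] at this
      simp at this
    by_contra! hneg
    have hle : ∀ z ∈ V, 0 ≤ inner ℝ v (z - v) := fun z hz => by
      obtain ⟨a, ha, he⟩ := inCone_dirs hV hv hz
      rw [he, inner_sum]
      refine Finset.sum_nonneg fun u hu => ?_
      rw [inner_smul_right, hr u hu]
      exact mul_nonneg (ha u) (by linarith)
    have h1 := Finset.sum_nonneg hle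
    rw [← inner_sum, Finset.sum_sub_distrib, hsum, Finset.sum_const, zero_sub, inner_neg_right,
      ← Nat.cast_smul_eq_nsmul ℝ, inner_smul_right] at h1
    have h2 : 0 < (V.card : ℝ) := by exact_mod_cast Finset.card_pos.2 ⟨v, hv⟩
    have h3 := mul_pos h2 (real_inner_self_pos.2 hv0)
    linarith
  have hbip : Bip V A B (-inner ℝ x u₀) (1 + inner ℝ x u₀)
      (inner ℝ x x + inner ℝ x u₀) := by
    have iA : ∀ v ∈ A, ∀ u ∈ dirs V v, inner ℝ v u = -(-inner ℝ x u₀) := fun v hv u hu => by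
      obtain ⟨T, hT, h1, h2⟩ := hadjA v _ (mem_dirs.1 hu) hv
      have : T u₀ = u := by
        rw [hw, map_add, h1, add_right_inj] at h2
        exact h2
      rw [← h1, ← this, T.inner_map_map, neg_neg]
    have iB : ∀ v ∈ B, ∀ u ∈ dirs V v, inner ℝ v u = -(1 + inner ℝ x u₀) := fun v hv u hu => by
      obtain ⟨T, hT, h1, h2⟩ := hadjB v _ (mem_dirs.1 hu) hv
      have : T (-u₀) = u := by
        rw [← h1, hw, map_add, add_assoc, left_eq_add] at h2
        rw [map_neg]
        exact neg_eq_of_add_eq_zero_right h2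
      rw [← h1, ← this, T.inner_map_map, hw, inner_neg_right, inner_add_left, hu₀1]
      ring
    refine ⟨fun z => ⟨hAB z, fun h => h.elim (·.1) (·.1)⟩, fun z hz hz' => hdis ⟨z, hz, hz'⟩, hV,
      ?_, ?_, hlen, iA, iB, hnonneg x hx _ (iA x hxA), hnonneg w hxw.2.1 _ (iB w hwB), by ring,
      ?_, ?_⟩
    · intro v v' hvv' hv
      obtain ⟨T, hT, -, rfl⟩ := hadjA v v' hvv' hv
      exact hstabB w hwB T hT
    · intro v v' hvv' hv
      obtain ⟨T, hT, -, rfl⟩ := hadjB v v' hvv' hv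
      exact hstabA x hxA T hT
    · rintro _ ⟨-, T, -, rfl⟩
      rw [T.inner_map_map]
      ring
    · rintro _ ⟨-, T, -, rfl⟩
      rw [T.inner_map_map, hw, inner_add_left, inner_add_right, inner_add_right, hu₀1,
        real_inner_comm x u₀]
      ring
  have hflB : ∀ v ∈ B, ∀ v' ∈ B, ∀ u ∈ dirs V v, ∀ u' ∈ dirs V v',
      ∃ T, IsSym V c T ∧ T v = v' ∧ T u = u' := by
    intro v hv v' hv' u hu u' hu'
    obtain ⟨T, hT, h1, h2⟩ := hadjB v _ (mem_dirs.1 hu) hv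
    obtain ⟨S, hS, h3, h4⟩ := hadjB v' _ (mem_dirs.1 hu') hv'
    have e1 : T.symm v = w := by rw [LinearIsometryEquiv.symm_apply_eq, h1]
    have e2 : T.symm (v + u) = x := by rw [LinearIsometryEquiv.symm_apply_eq, h2]
    refine ⟨T.symm.trans S, hT.symm.trans hS, by simp [e1, h3], ?_⟩
    rw [← add_sub_cancel_left v u, map_sub]
    simp [e1, e2, h3, h4, -map_add]
  have hflA : ∀ v ∈ A, ∀ v' ∈ A, ∀ u ∈ dirs V v, ∀ u' ∈ dirs V v',
      ∃ T, IsSym V c T ∧ T v = v' ∧ T u = u' := by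
    intro v hv v' hv' u hu u' hu'
    obtain ⟨T, hT, h1, h2⟩ := hadjA v _ (mem_dirs.1 hu) hv
    obtain ⟨S, hS, h3, h4⟩ := hadjA v' _ (mem_dirs.1 hu') hv'
    have e1 : T.symm v = x := by rw [LinearIsometryEquiv.symm_apply_eq, h1]
    have e2 : T.symm (v + u) = w := by rw [LinearIsometryEquiv.symm_apply_eq, h2]
    refine ⟨T.symm.trans S, hT.symm.trans hS, by simp [e1, h3], ?_⟩
    rw [← add_sub_cancel_left v u, map_sub]
    simp [e1, e2, h3, h4, -map_add]
  rcases le_total (1 + inner ℝ x u₀) (-inner ℝ x u₀) with hle | hle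
  · obtain ⟨b, hb, T, hT, hTb⟩ := hbip.exists_isSym hle ⟨w, hwB⟩
      (fun v hv => hcard v hv.1) hflB
    exact hswap ⟨T b, hTb, hstabB b hb T hT⟩
  · obtain ⟨b, hb, T, hT, hTb⟩ := hbip.swap.exists_isSym hle ⟨x, hxA⟩
      (fun v hv => hcard v hv.1) hflA
    exact hswap ⟨T b, hstabA b hb T hT, hTb⟩

end Symmetry

section Polytopes

variable {E : Type*} [NormedAddCommGroup E] [InnerProductSpace ℝ E]

theorem exists_finset_eq_extremePoints_convexHull (S : Finset E) :
    ∃ V : Finset E, (V : Set E) = extremePoints ℝ (convexHull ℝ (S : Set E)) ∧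
      convexHull ℝ (S : Set E) = convexHull ℝ (V : Set E) := by
  have hfin : (extremePoints ℝ (convexHull ℝ (S : Set E))).Finite :=
    S.finite_toSet.subset extremePoints_convexHull_subset
  refine ⟨hfin.toFinset, hfin.coe_toFinset, ?_⟩
  rw [hfin.coe_toFinset]
  conv_lhs => rw [← closure_convexHull_extremePoints (S.finite_toSet.isCompact_convexHull ℝ)
    (convex_convexHull ℝ _)]
  exact (hfin.isClosed_convexHull ℝ).closure_eq

theorem allExposed_of_eq_extremePoints [FiniteDimensional ℝ E] {V : Finset E}
    (hV : (V : Set E) = extremePoints ℝ (convexHull ℝ (V : Set E))) : AllExposed V := by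
  classical
  intro v hv
  have hmem : v ∈ extremePoints ℝ (convexHull ℝ (V : Set E)) := hV ▸ hv
  rw [(convex_convexHull ℝ _).mem_extremePoints_iff_mem_sdiff_convexHull_sdiff] at hmem
  obtain ⟨l, u, hl, hu⟩ := geometric_hahn_banach_closed_point (convex_convexHull ℝ _)
    ((V.erase v).finite_toSet.isClosed_convexHull ℝ)
    (fun h => hmem.2 (convexHull_mono (fun x hx => by
      rw [Finset.mem_coe, Finset.mem_erase] at hx
      exact ⟨subset_convexHull ℝ _ hx.2, hx.1⟩) h))
  refine ⟨(InnerProductSpace.toDual ℝ E).symm l, fun x hx hxv => ?_⟩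
  rw [InnerProductSpace.toDual_symm_apply, InnerProductSpace.toDual_symm_apply]
  exact (hl x (subset_convexHull ℝ _ (Finset.mem_erase.2 ⟨hxv, hx⟩))).trans hu

theorem Adj.isExposed_segment {V : Finset E} {v w : E} (h : Adj V v w) :
    IsExposed ℝ (convexHull ℝ (V : Set E)) (segment ℝ v w) := by
  classical
  obtain ⟨hv, hw, hne, n, hn, hlt⟩ := h
  have hle : ∀ x ∈ convexHull ℝ (V : Set E), inner ℝ n x ≤ inner ℝ n v := by
    intro x hx
    refine convexHull_min (t := {x | innerSL ℝ n x ≤ inner ℝ n v}) (fun y hy => ?_)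
      (convex_halfSpace_le (innerSL ℝ n).isLinear _) hx
    rw [mem_ofPred_eq, innerSL_apply_apply]
    by_cases hyv : y = v
    · rw [hyv]
    by_cases hyw : y = w
    · rw [hyw, hn]
    exact (hlt y hy hyv hyw).le
  refine fun _ => ⟨innerSL ℝ n, Set.ext fun x => ⟨fun hx => ⟨?_, fun y hy => ?_⟩, fun hx => ?_⟩⟩
  · exact (convex_convexHull ℝ _).segment_subset (subset_convexHull ℝ _ hv)
      (subset_convexHull ℝ _ hw) hx
  · obtain ⟨a, b, -, -, hab, rfl⟩ := hx
    have := hle y hy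
    rw [innerSL_apply_apply, innerSL_apply_apply, inner_add_right, inner_smul_right,
      inner_smul_right, ← hn, ← add_mul, hab, one_mul]
    exact this
  · obtain ⟨hxP, hmax⟩ := hx
    have hxv : inner ℝ n v ≤ inner ℝ n x := hmax v (subset_convexHull ℝ _ hv)
    obtain ⟨a, ha, ha1, rfl⟩ := Finset.mem_convexHull'.1 hxP
    have hsum : ∑ y ∈ V, a y * (inner ℝ n v - inner ℝ n y) ≤ 0 := by
      rw [inner_sum] at hxv
      simp only [inner_smul_right] at hxv
      simp only [mul_sub, Finset.sum_sub_distrib, ← Finset.sum_mul, ha1]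
      linarith
    have hnn : ∀ y ∈ V, 0 ≤ a y * (inner ℝ n v - inner ℝ n y) := fun y hy =>
      mul_nonneg (ha y hy) (sub_nonneg.2 (hle y (subset_convexHull ℝ _ hy)))
    have hzero : ∀ y ∈ V, y ∉ ({v, w} : Finset E) → a y = 0 := by
      intro y hy hyvw
      simp only [Finset.mem_insert, Finset.mem_singleton, not_or] at hyvw
      have := (Finset.sum_eq_zero_iff_of_nonneg hnn).1
        (le_antisymm hsum (Finset.sum_nonneg hnn)) y hy
      exact (mul_eq_zero.1 this).resolve_right (sub_pos.2 (hlt y hy hyvw.1 hyvw.2)).ne'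
    have hsub : ({v, w} : Finset E) ⊆ V := by
      simp [Finset.insert_subset_iff, hv, hw]
    rw [← Finset.sum_subset hsub fun y hy h => hzero y hy h, Finset.sum_pair hne] at ha1
    rw [← Finset.sum_subset hsub fun y hy h => by rw [hzero y hy h, zero_smul],
      Finset.sum_pair hne]
    exact ⟨a v, a w, ha v hv, ha w hw, ha1, rfl⟩

theorem eq_or_eq_of_image_segment {P : Set E} {T : E ≃ₗᵢ[ℝ] E} {v w v' w' : E} (hvw : v ≠ w)
    (hv : T v ∈ extremePoints ℝ P) (hw : T w ∈ extremePoints ℝ P) (hv' : v' ∈ P) (hw' : w' ∈ P)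
    (h : T '' segment ℝ v w = segment ℝ v' w') :
    (T v = v' ∧ T w = w') ∨ (T v = w' ∧ T w = v') := by
  rw [mem_extremePoints_iff_forall_segment] at hv hw
  have h1 := hv.2 v' hv' w' hw' (h ▸ mem_image_of_mem T (left_mem_segment ℝ v w))
  have h2 := hw.2 v' hv' w' hw' (h ▸ mem_image_of_mem T (right_mem_segment ℝ v w))
  have hne : T v ≠ T w := fun e => hvw (T.injective e)
  grind

/-- Edge-transitivity implies vertex-transitivity, for finite sets of vertices. -/
theorem exists_image_eq_of_edge_transitive [FiniteDimensional ℝ E]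
    (hd : 4 ≤ Module.finrank ℝ E) {V : Finset E} (hV : AllExposed V)
    (hspan : ∀ U : Submodule ℝ E, (∀ x ∈ V, ∀ y ∈ V, x - y ∈ U) → U = ⊤)
    (hedge : ∀ v w v' w', Adj V v w → Adj V v' w' →
      ∃ T : E ≃ₗᵢ[ℝ] E, T '' (V : Set E) = V ∧ ((T v = v' ∧ T w = w') ∨ (T v = w' ∧ T w = v')))
    {x y : E} (hx : x ∈ V) (hy : y ∈ V) : ∃ T : E ≃ₗᵢ[ℝ] E, T '' (V : Set E) = V ∧ T x = y := by
  classical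
  by_cases hne : ∃ v w, Adj V v w
  swap
  · obtain ⟨a, -, he⟩ := inCone_dirs hV hx hy
    have : dirs V x = ∅ := Finset.eq_empty_of_forall_notMem fun u hu =>
      hne ⟨_, _, mem_dirs.1 hu⟩
    rw [this, Finset.sum_empty, sub_eq_zero] at he
    exact ⟨LinearIsometryEquiv.refl ℝ E, by simp, by simp [he]⟩
  obtain ⟨v₀, w₀, h₀⟩ := hne
  set ℓ : ℝ := ‖v₀ - w₀‖ with hℓ
  have hℓ0 : 0 < ℓ := norm_pos_iff.2 (sub_ne_zero.2 h₀.2.2.1)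
  have hlen : ∀ v w, Adj V v w → ‖v - w‖ = ℓ := by
    intro v w h
    obtain ⟨T, -, ⟨h1, h2⟩ | ⟨h1, h2⟩⟩ := hedge _ _ _ _ h₀ h
    · rw [← h1, ← h2, ← map_sub, T.norm_map]
    · rw [← h1, ← h2, ← map_sub, T.norm_map, norm_sub_rev]
  set c : E := (V.card : ℝ)⁻¹ • ∑ z ∈ V, z with hc
  have hcard : (V.card : ℝ) ≠ 0 := by
    exact_mod_cast Finset.card_ne_zero_of_mem hx
  have hTc : ∀ T : E ≃ₗᵢ[ℝ] E, T '' (V : Set E) = V → T c = c := by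
    intro T hT
    have himg : V.image T = V := by
      rw [← Finset.coe_inj, Finset.coe_image, hT]
    have hsum : ∑ z ∈ V, T z = ∑ z ∈ V, z := by
      conv_rhs => rw [← himg]
      rw [Finset.sum_image fun a _ b _ h => T.injective h]
    rw [hc, map_smul, map_sum, hsum]
  set φ : E → E := fun z => ℓ⁻¹ • (z - c) with hφ
  set ψ : E → E := fun z => ℓ • z + c with hψ
  have hψφ : ∀ z, ψ (φ z) = z := fun z => by simp [hφ, hψ, smul_smul, hℓ0.ne']
  have hφψ : ∀ z, φ (ψ z) = z := fun z => by simp [hφ, hψ, smul_smul, hℓ0.ne']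
  have hφsub : ∀ a b, φ a - φ b = ℓ⁻¹ • (a - b) := fun a b => by
    rw [hφ]; simp only [← smul_sub]; congr 1; abel
  have hφi : ∀ n a b : E, inner ℝ (id n) (φ a - φ b) = ℓ⁻¹ * inner ℝ n (a - b) := fun n a b => by
    rw [hφsub, inner_smul_right, id]
  have hψi : ∀ n a b : E, inner ℝ (id n) (ψ a - ψ b) = ℓ * inner ℝ n (a - b) := fun n a b => by
    simp only [hψ, id, add_sub_add_right_eq_sub, ← smul_sub, inner_smul_right]
  have hinv : (V.image φ).image ψ = V := by
    rw [Finset.image_image, show ψ ∘ φ = id from funext hψφ, Finset.image_id]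
  have hback : ∀ v w, Adj (V.image φ) v w → Adj V (ψ v) (ψ w) := fun v w h => by
    have := h.image hℓ0 hψi
    rwa [hinv] at this
  have hcomm : ∀ T : E ≃ₗᵢ[ℝ] E, T c = c → ∀ z, T (φ z) = φ (T z) := fun T h z => by
    simp only [hφ, map_smul, map_sub, h]
  have hmem : ∀ z ∈ V, φ z ∈ V.image φ := fun z hz => Finset.mem_image_of_mem φ hz
  obtain ⟨T, hT, hTx⟩ := exists_isSym_of_sum_eq_zero hd (V := V.image φ) (c := c)
    (hV.image (inv_pos.2 hℓ0) hφi) (fun U hU => hspan U fun a ha b hb => by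
      have := U.smul_mem ℓ (hU _ (hmem a ha) _ (hmem b hb))
      rwa [hφsub, smul_smul, mul_inv_cancel₀ hℓ0.ne', one_smul] at this)
    (by
      rw [Finset.sum_image fun a _ b _ h => by rw [← hψφ a, h, hψφ], hφ]
      simp only [← Finset.smul_sum, Finset.sum_sub_distrib, Finset.sum_const]
      rw [hc, ← Nat.cast_smul_eq_nsmul ℝ, smul_smul, mul_inv_cancel₀ hcard, one_smul, sub_self,
        smul_zero])
    (fun v u hu => by
      have h1 := hlen _ _ (hback _ _ (mem_dirs.1 hu))
      simp only [hψ, add_sub_add_right_eq_sub, ← smul_sub, sub_add_cancel_left, norm_smul,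
        norm_neg, Real.norm_eq_abs, abs_of_pos hℓ0] at h1
      rw [real_inner_self_eq_norm_sq, mul_right_eq_self₀.1 h1 |>.resolve_right hℓ0.ne', one_pow])
    (fun v w v' w' h h' => by
      obtain ⟨T, hT, hTv⟩ := hedge _ _ _ _ (hback _ _ h) (hback _ _ h')
      have hφT : ∀ a b, T (ψ a) = ψ b → T a = b := fun a b hab => by
        rw [← hφψ a, hcomm T (hTc T hT), hab, hφψ]
      refine ⟨T, IsSym.of_mem (fun z hz => ?_) (hTc T hT),
        hTv.imp (fun h => ⟨hφT _ _ h.1, hφT _ _ h.2⟩) (fun h => ⟨hφT _ _ h.1, hφT _ _ h.2⟩)⟩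
      obtain ⟨z', hz', rfl⟩ := Finset.mem_image.1 hz
      rw [hcomm T (hTc T hT)]
      refine hmem _ ?_
      have : T z' ∈ T '' (V : Set E) := mem_image_of_mem T hz'
      rwa [hT] at this)
    (φ x) (hmem x hx) (φ y) (hmem y hy)
  have hψT : ∀ a, T (ψ a) = ψ (T a) := fun a => by
    simp only [hψ, map_add, map_smul, hT.2]
  refine ⟨T, ?_, by rw [← hψφ x, hψT, hTx, hψφ]⟩
  refine (IsSym.of_mem (c := c) (fun z hz => ?_) hT.2).1
  obtain ⟨z', hz', he⟩ := Finset.mem_image.1 (hT.mem (hmem z hz))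
  rw [← hψφ z, hψT, ← he, hψφ]
  exact hz'

end Polytopes

/-- In dimension `d ≥ 4`, every edge-transitive full-dimensional convex
polytope is vertex-transitive. -/
theorem edgeTransitive_implies_vertexTransitive {d : ℕ} (hd : 4 ≤ d)
    (P : Set (Euc d)) (hP : IsPolytope P) (hfull : FullDim P)
    (hET : EdgeTransitive P) : VertexTransitive P := by
  obtain ⟨S, hS⟩ := hP
  obtain ⟨V, hVext, hVP⟩ := exists_finset_eq_extremePoints_convexHull S
  rw [← hS] at hVext hVP
  have hexp : AllExposed V := allExposed_of_eq_extremePoints (by rw [← hVP, hVext])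
  intro x hx y hy
  rw [← hVext] at hx hy
  suffices h : ∃ T : Euc d ≃ₗᵢ[ℝ] Euc d, T '' (V : Set (Euc d)) = V ∧ T x = y by
    obtain ⟨T, hT, hTx⟩ := h
    refine ⟨T, ?_, hTx⟩
    have := T.toLinearEquiv.toLinearMap.image_convexHull (V : Set (Euc d))
    simp only [LinearEquiv.coe_coe, LinearIsometryEquiv.coe_toLinearEquiv] at this
    rw [IsAut, hVP, this, hT]
  refine exists_image_eq_of_edge_transitive (by simpa using hd) hexp
    (fun U hU => ?_) (fun v w v' w' h h' => ?_) hx hy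
  · have htop : vectorSpan ℝ (V : Set (Euc d)) = ⊤ := by
      rw [← direction_affineSpan, ← affineSpan_convexHull, ← hVP, hfull, AffineSubspace.direction_top]
    rw [eq_top_iff, ← htop, vectorSpan_def, Submodule.span_le]
    rintro _ ⟨a, ha, b, hb, rfl⟩
    exact hU a ha b hb
  · have hedge : ∀ a b, Adj V a b → IsEdgeSet P (segment ℝ a b) := fun a b hab =>
      ⟨a, b, ⟨hab.2.2.1, hVP ▸ hab.isExposed_segment⟩, rfl⟩
    obtain ⟨T, hT, hTe⟩ := hET _ _ (hedge v w h) (hedge v' w' h')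
    have hTV : T '' (V : Set (Euc d)) = V := by
      rw [hVext, image_extremePoints, hT]
    have hmem : ∀ z ∈ V, T z ∈ extremePoints ℝ P := fun z hz => by
      rw [← hVext, ← hTV]
      exact mem_image_of_mem T hz
    have hsub : ∀ z ∈ V, z ∈ P := fun z hz => by
      rw [hVP]
      exact subset_convexHull ℝ _ hz
    exact ⟨T, hTV, eq_or_eq_of_image_segment h.2.2.1 (hmem v h.1) (hmem w h.2.1)
      (hsub _ h'.1) (hsub _ h'.2.1) hTe⟩
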